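/- arXiv:2205.01191 — 7 statements merged into one kernel-verified Lean document; each statement's English description precedes it below -/
import Mathlib

section
/- Let k ≥ 1 and let G be a finite simple k-creature-free graph on n vertices. Then for every vertex v of G, the family S_G^v = { N(v) ∩ S : S is a minimal separator of G with v ∉ S } has at most n^{k+1} members. -/
open SimpleGraph

/-- `S` is a `u`-`v`-separator in `G`: `u, v ∉ S` and every walk from `u` to `v` meets `S`
(i.e. `u` and `v` lie in different components of `G − S`). -/
def IsUVSeparator {V : Type*} (G : SimpleGraph V) (S : Set V) (u v : V) : Prop :=
  u ∉ S ∧ v ∉ S ∧ ∀ p : G.Walk u v, ∃ w ∈ p.support, w ∈ S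

/-- `S` is an inclusion-minimal `u`-`v`-separator in `G`. -/
def IsMinimalUVSeparator {V : Type*} (G : SimpleGraph V) (S : Set V) (u v : V) : Prop :=
  IsUVSeparator G S u v ∧ ∀ S' ⊂ S, ¬ IsUVSeparator G S' u v

/-- `S` is a minimal separator of `G`. -/
def IsMinimalSeparator {V : Type*} (G : SimpleGraph V) (S : Set V) : Prop :=
  ∃ u v, IsMinimalUVSeparator G S u v

/-- The (open) neighborhood of a set `A`: vertices outside `A` with a neighbor in `A`. -/
def nbhd {V : Type*} (G : SimpleGraph V) (A : Set V) : Set V :=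
  {w | w ∉ A ∧ ∃ a ∈ A, G.Adj w a}

/-- `(A, B, X, Y)` is a `k`-creature in `G`. -/
def IsCreature {V : Type*} (G : SimpleGraph V) (k : ℕ) (A B X Y : Set V) : Prop :=
  A.Nonempty ∧ B.Nonempty ∧ X.Nonempty ∧ Y.Nonempty ∧
  Disjoint A B ∧ Disjoint A X ∧ Disjoint A Y ∧
  Disjoint B X ∧ Disjoint B Y ∧ Disjoint X Y ∧
  (G.induce A).Connected ∧ (G.induce B).Connected ∧
  (∀ a ∈ A, ∀ w ∈ Y ∪ B, ¬ G.Adj a w) ∧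
  (∀ b ∈ B, ∀ w ∈ A ∪ X, ¬ G.Adj b w) ∧
  (∀ x ∈ X, ∃ a ∈ A, G.Adj x a) ∧
  (∀ y ∈ Y, ∃ b ∈ B, G.Adj y b) ∧
  ∃ x y : Fin k → V, Function.Injective x ∧ Function.Injective y ∧
    Set.range x = X ∧ Set.range y = Y ∧
    ∀ i j, G.Adj (x i) (y j) ↔ i = j

/-- `G` is `k`-creature-free. -/
def CreatureFree {V : Type*} (G : SimpleGraph V) (k : ℕ) : Prop :=
  ∀ A B X Y : Set V, ¬ IsCreature G k A B X Y

/-- The `k`-skinny ladder: vertices `(0, i) = pᵢ`, `(1, i) = qᵢ`, `(2, i) = rᵢ`;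
edges `pᵢpᵢ₊₁`, `qᵢqᵢ₊₁`, `pᵢrᵢ`, `qᵢrᵢ`. -/
def skinnyLadder (k : ℕ) : SimpleGraph (Fin 3 × Fin k) :=
  SimpleGraph.fromRel (fun a b =>
    (a.1 = b.1 ∧ a.1 ≠ 2 ∧ (a.2 : ℕ) + 1 = (b.2 : ℕ)) ∨
    (a.1 ≠ 2 ∧ b.1 = 2 ∧ a.2 = b.2))

/-- `H` is an induced minor of `G`: there are pairwise disjoint nonempty connected branch sets
realizing the adjacencies of `H` exactly. -/
def IsInducedMinor {W V : Type*} (H : SimpleGraph W) (G : SimpleGraph V) : Prop :=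
  ∃ B : W → Set V,
    (∀ h, (B h).Nonempty) ∧
    (∀ h, (G.induce (B h)).Connected) ∧
    (Pairwise fun h h' => Disjoint (B h) (B h')) ∧
    ∀ h h', h ≠ h' → ((∃ a ∈ B h, ∃ b ∈ B h', G.Adj a b) ↔ H.Adj h h')

/-- `ζ_G(S)`: the maximum size of an independent set `I ⊆ S` such that no vertex outside `S`
has more than one neighbor in `I`. -/
noncomputable def zeta {V : Type*} (G : SimpleGraph V) (S : Set V) : ℕ :=
  sSup {n | ∃ I : Set V, I ⊆ S ∧ (∀ a ∈ I, ∀ b ∈ I, ¬ G.Adj a b) ∧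
    (∀ v, v ∉ S → (I ∩ G.neighborSet v).ncard ≤ 1) ∧ I.ncard = n}

/-- `D` is a connected component of `G[U]`. -/
def IsCompOf {V : Type*} (G : SimpleGraph V) (U D : Set V) : Prop :=
  D ⊆ U ∧ D.Nonempty ∧ (G.induce D).Connected ∧
  ∀ a ∈ D, ∀ b ∈ U, G.Adj a b → b ∈ D

/-- Vertices reachable from `b` through vertices of `U`. -/
def RSet {V : Type*} (G : SimpleGraph V) (U : Set V) (b : V) : Set V :=
  {z | Relation.ReflTransGen (fun c d => G.Adj c d ∧ d ∈ U) b z}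

theorem rset_self {V : Type*} (G : SimpleGraph V) (U : Set V) (b : V) : b ∈ RSet G U b :=
  Relation.ReflTransGen.refl

theorem rset_step {V : Type*} {G : SimpleGraph V} {U : Set V} {b c d : V}
    (hc : c ∈ RSet G U b) (h : G.Adj c d) (hd : d ∈ U) : d ∈ RSet G U b :=
  Relation.ReflTransGen.tail hc ⟨h, hd⟩

theorem rset_sub {V : Type*} {G : SimpleGraph V} {U : Set V} {b c : V} (hb : b ∈ U)
    (hc : c ∈ RSet G U b) : c ∈ U := by
  induction hc with
  | refl => exact hb
  | tail _ h _ => exact h.2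

theorem rset_conn {V : Type*} (G : SimpleGraph V) (U : Set V) (b : V) :
    (G.induce (RSet G U b)).Connected := by
  rw [SimpleGraph.connected_iff_exists_forall_reachable]
  refine ⟨⟨b, rset_self G U b⟩, ?_⟩
  rintro ⟨z, hz⟩
  have hz' : Relation.ReflTransGen (fun c d => G.Adj c d ∧ d ∈ U) b z := hz
  induction hz' with
  | refl => exact SimpleGraph.Reachable.refl _
  | @tail c d h1 h2 ih =>
    refine (ih h1).trans (SimpleGraph.Adj.reachable ?_)
    exact h2.1

/-- Connectedness of `B` seen from `b`: a subset containing `b` closed under adjacency in `B`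
contains `B`. -/
def ConnFrom {V : Type*} (G : SimpleGraph V) (b : V) (B : Set V) : Prop :=
  b ∈ B ∧ ∀ C : Set V, b ∈ C → (∀ c ∈ C, ∀ d ∈ B, G.Adj c d → d ∈ C) → B ⊆ C

theorem rset_connFrom {V : Type*} (G : SimpleGraph V) (U : Set V) (b : V) :
    ConnFrom G b (RSet G U b) := by
  refine ⟨rset_self G U b, fun C hb hC z hz => ?_⟩
  have hz' : Relation.ReflTransGen (fun c d => G.Adj c d ∧ d ∈ U) b z := hz
  induction hz' with
  | refl => exact hb
  | @tail c d h1 h2 ih => exact hC c (ih h1) d hz h2.1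

theorem walk_cross {V : Type*} {G : SimpleGraph V} (C : Set V) {u w : V} (p : G.Walk u w)
    (hu : u ∈ C) (hw : w ∉ C) : ∃ c ∈ C, ∃ d ∉ C, G.Adj c d ∧ d ∈ p.support := by
  induction p with
  | nil => exact absurd hu hw
  | @cons a b c h q ih =>
    by_cases hb : b ∈ C
    · obtain ⟨c, hc, d, hd, h1, h2⟩ := ih hb hw
      exact ⟨c, hc, d, hd, h1, by simp [h2]⟩
    · exact ⟨a, hu, b, hb, h, by simp⟩

theorem minsep_symm {V : Type*} {G : SimpleGraph V} {S : Set V} {u w : V}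
    (h : IsMinimalUVSeparator G S u w) : IsMinimalUVSeparator G S w u := by
  have key : ∀ {S : Set V} {u w : V}, IsUVSeparator G S u w → IsUVSeparator G S w u := by
    intro S u w h
    refine ⟨h.2.1, h.1, fun p => ?_⟩
    obtain ⟨x, hx, hS⟩ := h.2.2 p.reverse
    exact ⟨x, by simpa using hx, hS⟩
  exact ⟨key h.1, fun S' hS' h' => h.2 S' hS' (key h')⟩

theorem rset_not_mem {V : Type*} {G : SimpleGraph V} {S : Set V} {u w : V}
    (h : IsUVSeparator G S u w) {z : V} (hz : z ∈ RSet G Sᶜ u) (hz2 : z ∈ RSet G Sᶜ w) :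
    False := by
  have key : ∀ u z : V, u ∉ S → z ∈ RSet G Sᶜ u → ∃ p : G.Walk u z, ∀ x ∈ p.support, x ∉ S := by
    intro u z hu hz
    have hz' : Relation.ReflTransGen (fun c d => G.Adj c d ∧ d ∈ Sᶜ) u z := hz
    induction hz' with
    | refl => exact ⟨.nil, by simpa using hu⟩
    | @tail c d h1 h2 ih =>
      obtain ⟨p, hp⟩ := ih h1
      refine ⟨p.concat h2.1, fun x hx => ?_⟩
      rw [SimpleGraph.Walk.support_concat] at hx
      simp only [List.concat_eq_append, List.mem_append, List.mem_singleton] at hx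
      rcases hx with hx | rfl
      · exact hp x hx
      · exact h2.2
  obtain ⟨p, hp⟩ := key u z h.1 hz
  obtain ⟨q, hq⟩ := key w z h.2.1 hz2
  obtain ⟨x, hx, hS⟩ := h.2.2 (p.append q.reverse)
  rw [SimpleGraph.Walk.mem_support_append_iff] at hx
  rcases hx with hx | hx
  · exact hp x hx hS
  · exact hq x (by simpa using hx) hS

theorem minsep_full {V : Type*} {G : SimpleGraph V} {S : Set V} {u w : V}
    (h : IsMinimalUVSeparator G S u w) :
    ∀ s ∈ S, ∃ c ∈ RSet G Sᶜ u, G.Adj s c := by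
  by_contra! hcon
  obtain ⟨s, hs, hsc⟩ := hcon
  refine h.2 {s ∈ S | ∃ c ∈ RSet G Sᶜ u, G.Adj s c} ?_ ?_
  · refine ⟨fun x hx => hx.1, fun hsub => ?_⟩
    obtain ⟨_, c, hc, hadj⟩ := hsub hs
    exact hsc c hc hadj
  · refine ⟨fun hx => h.1.1 hx.1, fun hx => h.1.2.1 hx.1, fun p => ?_⟩
    have hw : w ∉ RSet G Sᶜ u := fun hw => rset_not_mem h.1 hw (rset_self _ _ _)
    obtain ⟨c, hc, d, hd, hadj, hsup⟩ := walk_cross _ p (rset_self G Sᶜ u) hw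
    refine ⟨d, hsup, ?_, c, hc, hadj.symm⟩
    by_contra hdS
    exact hd (rset_step hc hadj hdS)

/-- The traces witnessed by a connected set through `b`. -/
def Trace {V : Type*} (G : SimpleGraph V) (v b : V) (T : Set V) : Prop :=
  ∃ B : Set V, ConnFrom G b B ∧ v ∉ B ∧ (∀ c ∈ B, ¬ G.Adj v c) ∧
    T = {x | G.Adj v x ∧ ∃ c ∈ B, G.Adj x c}

theorem exists_trace {V : Type*} {G : SimpleGraph V} {S : Set V} {v : V}
    (hS : IsMinimalSeparator G S) (hv : v ∉ S) : ∃ b, Trace G v b (G.neighborSet v ∩ S) := by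
  have key : ∀ u w : V, IsMinimalUVSeparator G S u w → v ∉ RSet G Sᶜ u →
      Trace G v u (G.neighborSet v ∩ S) := by
    intro u w h hvu
    refine ⟨RSet G Sᶜ u, rset_connFrom _ _ _, hvu,
      fun c hc hadj => hvu (rset_step hc hadj.symm hv), ?_⟩
    ext x
    constructor
    · rintro ⟨h1, h2⟩
      exact ⟨h1, minsep_full h x h2⟩
    · rintro ⟨h1, c, hc, h2⟩
      refine ⟨h1, ?_⟩
      by_contra hx
      exact hvu (rset_step (rset_step hc h2.symm hx) h1.symm hv)
  obtain ⟨u, w, h⟩ := hS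
  by_cases hvu : v ∈ RSet G Sᶜ u
  · exact ⟨w, key w u (minsep_symm h) fun hvw => rset_not_mem h.1 hvu hvw⟩
  · exact ⟨u, key u w h hvu⟩

theorem creature_of_shatter {V : Type*} {G : SimpleGraph V} {v b : V} {k : ℕ} (hk : 1 ≤ k)
    (x : Fin k → V) (hx : Function.Injective x)
    (hsh : ∀ X' ⊆ Set.range x, ∃ T, Trace G v b T ∧ Set.range x ∩ T = X') :
    ¬ CreatureFree G k := by
  intro hfree
  have hv : ∀ i, G.Adj v (x i) := by
    intro i
    obtain ⟨T, ⟨B, -, -, -, rfl⟩, hT⟩ := hsh _ subset_rfl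
    have : x i ∈ Set.range x := ⟨i, rfl⟩
    rw [← hT] at this
    exact this.2.1
  set U : Set V := {w | w ≠ v ∧ ¬ G.Adj v w ∧ ∀ i, ¬ G.Adj (x i) w} with hU
  have hb : b ∈ U := by
    obtain ⟨T, ⟨B, h1, h2, h3, rfl⟩, hT⟩ := hsh ∅ (Set.empty_subset _)
    refine ⟨fun h => h2 (h ▸ h1.1), h3 b h1.1, fun i hi => ?_⟩
    have : x i ∈ (∅ : Set V) := by
      rw [← hT]
      exact ⟨⟨i, rfl⟩, hv i, b, h1.1, hi⟩
    exact this
  have hy : ∀ i, ∃ y, y ≠ v ∧ ¬ G.Adj v y ∧ (∀ j, G.Adj (x j) y ↔ j = i) ∧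
      ∃ c ∈ RSet G U b, G.Adj y c := by
    intro i
    obtain ⟨T, ⟨B, h1, h2, h3, rfl⟩, hT⟩ := hsh {x i} (by rintro _ rfl; exact ⟨i, rfl⟩)
    have hi : x i ∈ ({x i} : Set V) := rfl
    have honly : ∀ j, ∀ d ∈ B, G.Adj (x j) d → j = i := by
      intro j d hd hj
      have : x j ∈ ({x i} : Set V) := by
        rw [← hT]
        exact ⟨⟨j, rfl⟩, hv j, d, hd, hj⟩
      exact hx this
    rw [← hT] at hi
    obtain ⟨-, -, d, hd, hid⟩ := hi
    have hex : ∃ c ∈ RSet G U b, ∃ y ∈ B, G.Adj c y ∧ y ∉ RSet G U b := by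
      by_contra! hcon
      exact (rset_sub hb (h1.2 (RSet G U b) (rset_self _ _ _) hcon hd)).2.2 i hid
    obtain ⟨c, hc, y, hyB, hcy, hyR⟩ := hex
    have hyv : y ≠ v := fun h => h2 (h ▸ hyB)
    have hyU : y ∉ U := fun h => hyR (rset_step hc hcy h)
    have : ∃ j, G.Adj (x j) y := by
      by_contra! hcon
      exact hyU ⟨hyv, h3 y hyB, hcon⟩
    obtain ⟨j, hj⟩ := this
    obtain rfl := honly j y hyB hj
    refine ⟨y, hyv, h3 y hyB, fun l => ⟨honly l y hyB, ?_⟩, c, hc, hcy.symm⟩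
    rintro rfl
    exact hj
  choose y hyv hvy hxy hyc using hy
  have hRU : ∀ z ∈ RSet G U b, z ∈ U := fun z hz => rset_sub hb hz
  have hne : Nonempty (Fin k) := ⟨⟨0, hk⟩⟩
  refine hfree {v} (RSet G U b) (Set.range x) (Set.range y) ⟨⟨v, rfl⟩, ⟨b, rset_self _ _ _⟩,
    Set.range_nonempty x, Set.range_nonempty y, ?_, ?_, ?_, ?_, ?_, ?_, ?_, rset_conn G U b,
    ?_, ?_, ?_, ?_, x, y, hx, ?_, rfl, rfl, ?_⟩
  · rw [Set.disjoint_singleton_left]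
    exact fun h => (hRU v h).1 rfl
  · rw [Set.disjoint_singleton_left]
    rintro ⟨i, hi⟩
    exact (hv i).ne hi.symm
  · rw [Set.disjoint_singleton_left]
    rintro ⟨i, hi⟩
    exact hyv i hi
  · rw [Set.disjoint_left]
    rintro z hz ⟨i, rfl⟩
    exact (hRU _ hz).2.1 (hv i)
  · rw [Set.disjoint_left]
    rintro z hz ⟨i, rfl⟩
    exact (hRU _ hz).2.2 i ((hxy i i).2 rfl)
  · rw [Set.disjoint_left]
    rintro z ⟨i, rfl⟩ ⟨j, hj⟩
    exact hvy j (hj ▸ hv i)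
  · rw [SimpleGraph.connected_iff_exists_forall_reachable]
    refine ⟨⟨v, rfl⟩, ?_⟩
    rintro ⟨z, rfl⟩
    exact SimpleGraph.Reachable.refl _
  · rintro a rfl w (⟨i, rfl⟩ | hw)
    · exact hvy i
    · exact (hRU w hw).2.1
  · rintro z hz w (rfl | ⟨i, rfl⟩) h
    · exact (hRU z hz).2.1 h.symm
    · exact (hRU z hz).2.2 i h.symm
  · rintro _ ⟨i, rfl⟩
    exact ⟨v, rfl, (hv i).symm⟩
  · rintro _ ⟨i, rfl⟩
    exact hyc i
  · intro i j hij
    have := (hxy i i).2 rfl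
    rw [hij] at this
    exact (hxy j i).1 this
  · intro i j
    exact hxy j i

theorem sum_choose_le (n : ℕ) (hn : 2 ≤ n) (k : ℕ) :
    ∑ i ∈ Finset.range (k + 1), n.choose i ≤ n ^ (k + 1) := by
  induction k with
  | zero => simp; omega
  | succ k ih =>
    rw [Finset.sum_range_succ]
    have := Nat.choose_le_pow n (k + 1)
    calc _ ≤ n ^ (k + 1) + n ^ (k + 1) := by gcongr
      _ = n ^ (k + 1) * 2 := by ring
      _ ≤ n ^ (k + 1) * n := by gcongr
      _ = _ := by ring

open Classical in
theorem trace_card {V : Type*} [Fintype V] {G : SimpleGraph V} {k : ℕ} (hk : 1 ≤ k)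
    (hfree : CreatureFree G k) (v b : V) :
    (Finset.univ.filter fun T : Finset V => Trace G v b (T : Set V)).card
      ≤ Fintype.card V ^ k := by
  set F := Finset.univ.filter fun T : Finset V => Trace G v b (T : Set V) with hF
  by_cases hvb : v = b
  · have : F = ∅ := by
      rw [hF, Finset.filter_eq_empty_iff]
      rintro T - ⟨B, h1, h2, -⟩
      exact h2 (hvb ▸ h1.1)
    simp [this]
  have hn : 2 ≤ Fintype.card V := by
    have := Fintype.one_lt_card_iff.2 ⟨v, b, hvb⟩
    omega
  have hvc : F.vcDim < k := by
    by_contra! hle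
    have hFne : F.shatterer.Nonempty := by
      rw [Finset.nonempty_iff_ne_empty]
      intro h
      have : F.vcDim = 0 := by simp [Finset.vcDim, h]
      omega
    obtain ⟨s, hs, hcard⟩ := Finset.exists_mem_eq_sup F.shatterer hFne Finset.card
    have hsk : k ≤ s.card := by rw [← hcard]; exact hle
    obtain ⟨t, hts, htk⟩ := Finset.exists_subset_card_eq hsk
    have hsh : F.Shatters t := (Finset.mem_shatterer.1 hs).mono_right hts
    let e := (t.equivFinOfCardEq htk).symm
    have hrange : Set.range (fun i => (e i : V)) = (t : Set V) := by
      ext z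
      constructor
      · rintro ⟨i, rfl⟩
        exact (e i).2
      · intro hz
        exact ⟨e.symm ⟨z, hz⟩, by simp⟩
    refine creature_of_shatter (v := v) (b := b) hk (fun i => (e i : V))
      (Subtype.val_injective.comp e.injective) ?_ hfree
    intro X' hX'
    rw [hrange] at hX' ⊢
    have hsub : X'.toFinset ⊆ t := by
      intro z hz
      exact hX' (by simpa using hz)
    obtain ⟨T, hT, hTX⟩ := hsh hsub
    refine ⟨T, (Finset.mem_filter.1 hT).2, ?_⟩
    have := congrArg (fun s : Finset V => (s : Set V)) hTX
    simpa using this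
  calc F.card ≤ F.shatterer.card := Finset.card_le_card_shatterer F
    _ ≤ ∑ i ∈ Finset.Iic F.vcDim, (Fintype.card V).choose i := Finset.card_shatterer_le_sum_vcDim
    _ ≤ ∑ i ∈ Finset.range (k - 1 + 1), (Fintype.card V).choose i := by
      apply Finset.sum_le_sum_of_subset
      intro i hi
      simp only [Finset.mem_Iic, Finset.mem_range] at *
      omega
    _ ≤ Fintype.card V ^ (k - 1 + 1) := sum_choose_le _ hn _
    _ = _ := by rw [Nat.sub_add_cancel hk]

/-- Lemma 5, Gartland–Lokshtanov: in a `k`-creature-free graph `G` on `n`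
vertices, for every vertex `v` the family `S_G^v = {N(v) ∩ S : S minimal separator, v ∉ S}`
has at most `n^(k+1)` members. -/
theorem creatureFree_card_neighborhood_traces_le
    (k : ℕ) (hk : 1 ≤ k) {V : Type*} [Fintype V] (G : SimpleGraph V)
    (hfree : CreatureFree G k) (v : V) :
    {T : Set V | ∃ S : Set V, IsMinimalSeparator G S ∧ v ∉ S ∧
        T = G.neighborSet v ∩ S}.ncard ≤ Fintype.card V ^ (k + 1) := by
  classical
  let F : V → Finset (Finset V) := fun b =>
    Finset.univ.filter fun T : Finset V => Trace G v b (T : Set V)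
  let W : Finset (Set V) := (Finset.univ.biUnion F).image fun T : Finset V => (T : Set V)
  have hsub : {T : Set V | ∃ S : Set V, IsMinimalSeparator G S ∧ v ∉ S ∧
        T = G.neighborSet v ∩ S} ⊆ (W : Set (Set V)) := by
    rintro T ⟨S, hS, hvS, rfl⟩
    obtain ⟨b, hb⟩ := exists_trace hS hvS
    simp only [W, F, Finset.coe_image, Set.mem_image, Finset.mem_coe, Finset.mem_biUnion,
      Finset.mem_univ, true_and, Finset.mem_filter]
    exact ⟨(G.neighborSet v ∩ S).toFinset, ⟨b, by rw [Set.coe_toFinset]; exact hb⟩,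
      Set.coe_toFinset _⟩
  calc _ ≤ (W : Set (Set V)).ncard := Set.ncard_le_ncard hsub W.finite_toSet
    _ = W.card := Set.ncard_coe_finset W
    _ ≤ (Finset.univ.biUnion F).card := Finset.card_image_le
    _ ≤ (Finset.univ : Finset V).card * Fintype.card V ^ k :=
      Finset.card_biUnion_le_card_mul _ _ _ fun b _ => by
        convert trace_card hk hfree v b
    _ = _ := by rw [Finset.card_univ, pow_succ, mul_comm]
end

section
/- Let k ≥ 1 and let G be a finite simple k-creature-free graph that contains a minimal separator S with ζ_G(S) > (8k²)^{k+2}. Then G contains the k-skinny ladder as an induced minor. -/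
open SimpleGraph

/-- Two vertex sets are disjoint with no edges between them. -/
def SLAnti {V : Type*} (G : SimpleGraph V) (D E : Set V) : Prop :=
  Disjoint D E ∧ ∀ a ∈ D, ∀ b ∈ E, ¬ G.Adj a b

lemma SLAnti.symm {V : Type*} {G : SimpleGraph V} {D E : Set V} (h : SLAnti G D E) :
    SLAnti G E D :=
  ⟨h.1.symm, fun a ha b hb hab => h.2 b hb a ha hab.symm⟩

lemma SLAnti.mono {V : Type*} {G : SimpleGraph V} {D E D' E' : Set V} (h : SLAnti G D E)
    (hD : D' ⊆ D) (hE : E' ⊆ E) : SLAnti G D' E' :=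
  ⟨h.1.mono hD hE, fun a ha b hb => h.2 a (hD ha) b (hE hb)⟩

lemma sl_conn_of_walks {V : Type*} {G : SimpleGraph V} {s : Set V} (u : V) (hu : u ∈ s)
    (h : ∀ v ∈ s, ∃ w : G.Walk u v, ∀ x ∈ w.support, x ∈ s) : (G.induce s).Connected := by
  rw [connected_iff_exists_forall_reachable]
  refine ⟨⟨u, hu⟩, ?_⟩
  rintro ⟨v, hv⟩
  obtain ⟨w, hw⟩ := h v hv
  exact ⟨w.induce s hw⟩

lemma sl_walk_of_conn {V : Type*} {G : SimpleGraph V} {s : Set V} (h : (G.induce s).Connected)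
    {u v : V} (hu : u ∈ s) (hv : v ∈ s) : ∃ w : G.Walk u v, ∀ x ∈ w.support, x ∈ s := by
  have key : ∀ (a b : s) (_ : (G.induce s).Walk a b),
      ∃ w' : G.Walk (a : V) (b : V), ∀ x ∈ w'.support, x ∈ s := by
    intro a b w
    induction w with
    | nil => exact ⟨Walk.nil, by simp⟩
    | cons hadj _ ih =>
      rename_i a c _ _
      obtain ⟨w', hw'⟩ := ih
      have hadj' : G.Adj (a : V) (c : V) := hadj
      refine ⟨Walk.cons hadj' w', ?_⟩
      intro x hx
      rw [Walk.support_cons, List.mem_cons] at hx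
      rcases hx with rfl | hx
      · exact a.2
      · exact hw' x hx
  obtain ⟨w⟩ := h.preconnected ⟨u, hu⟩ ⟨v, hv⟩
  exact key _ _ w

lemma sl_take_sub {V : Type*} {G : SimpleGraph V} {u v : V} (w : G.Walk u v) (n : ℕ) {x : V}
    (hx : x ∈ (w.take n).support) : x ∈ w.support := by
  rw [Walk.support_take] at hx
  exact List.mem_of_mem_take hx

lemma sl_drop_sub {V : Type*} {G : SimpleGraph V} {u v : V} (w : G.Walk u v) (n : ℕ) {x : V}
    (hx : x ∈ (w.drop n).support) : x ∈ w.support := by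
  rw [Walk.drop_support_eq_support_drop_min] at hx
  exact List.mem_of_mem_drop hx

/-- `p` restricted to the index set `J` is an induced path. -/
def SLPath {V : Type*} (G : SimpleGraph V) (p : ℕ → V) (J : Set ℕ) : Prop :=
  J.OrdConnected ∧ (∀ m ∈ J, ∀ n ∈ J, p m = p n → m = n) ∧
    ∀ m ∈ J, ∀ n ∈ J, (G.Adj (p m) (p n) ↔ m + 1 = n ∨ n + 1 = m)

lemma SLPath.mono {V : Type*} {G : SimpleGraph V} {p : ℕ → V} {J J' : Set ℕ}
    (h : SLPath G p J) (hJ : J' ⊆ J) (hc : J'.OrdConnected) : SLPath G p J' :=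
  ⟨hc, fun m hm n hn => h.2.1 m (hJ hm) n (hJ hn), fun m hm n hn => h.2.2 m (hJ hm) n (hJ hn)⟩

lemma SLPath.walk {V : Type*} {G : SimpleGraph V} {p : ℕ → V} {J : Set ℕ}
    (h : SLPath G p J) (a d : ℕ) (ha : a ∈ J) (had : a + d ∈ J) :
    ∃ w : G.Walk (p a) (p (a + d)), ∀ x ∈ w.support, x ∈ p '' J := by
  induction d with
  | zero => exact ⟨Walk.nil, by simpa using ⟨a, ha, rfl⟩⟩
  | succ d ih =>
    have hd : a + d ∈ J := h.1.out ha had ⟨by omega, by omega⟩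
    obtain ⟨w, hw⟩ := ih hd
    have hadj : G.Adj (p (a + d)) (p (a + (d + 1))) :=
      (h.2.2 _ hd _ had).2 (Or.inl (by omega))
    refine ⟨w.concat hadj, ?_⟩
    intro x hx
    rw [Walk.support_concat] at hx
    simp only [List.mem_append, List.mem_singleton] at hx
    rcases hx with hx | rfl
    · exact hw x hx
    · exact ⟨_, had, rfl⟩

lemma SLPath.connected {V : Type*} {G : SimpleGraph V} {p : ℕ → V} {J : Set ℕ}
    (h : SLPath G p J) (hJ : J.Nonempty) : (G.induce (p '' J)).Connected := by
  obtain ⟨a, ha⟩ := hJ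
  refine sl_conn_of_walks (p a) ⟨a, ha, rfl⟩ ?_
  rintro _ ⟨b, hb, rfl⟩
  rcases le_total a b with hab | hab
  · obtain ⟨d, rfl⟩ := Nat.exists_eq_add_of_le hab
    exact h.walk a d ha hb
  · obtain ⟨d, rfl⟩ := Nat.exists_eq_add_of_le hab
    obtain ⟨w, hw⟩ := h.walk b d hb ha
    exact ⟨w.reverse, by simpa using hw⟩

/-- Shortest paths inside a connected set. -/
lemma sl_shortest {V : Type*} {G : SimpleGraph V} {s : Set V} (h : (G.induce s).Connected)
    {u v : V} (hu : u ∈ s) (hv : v ∈ s) :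
    ∃ w : G.Walk u v, (∀ x ∈ w.support, x ∈ s) ∧ SLPath G w.getVert (Set.Iic w.length) := by
  classical
  have hex : ∃ n, ∃ w : G.Walk u v, (∀ x ∈ w.support, x ∈ s) ∧ w.length = n := by
    obtain ⟨w, hw⟩ := sl_walk_of_conn h hu hv
    exact ⟨_, w, hw, rfl⟩
  obtain ⟨w, hw, hlen⟩ := Nat.find_spec hex
  have hmin : ∀ w' : G.Walk u v, (∀ x ∈ w'.support, x ∈ s) → w.length ≤ w'.length := by
    intro w' hw'
    rw [hlen]
    exact Nat.find_min' hex ⟨w', hw', rfl⟩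
  refine ⟨w, hw, Set.ordConnected_Iic, ?_, ?_⟩
  · have key : ∀ m n, m < n → n ≤ w.length → w.getVert m ≠ w.getVert n := by
      intro m n hmn hn heq
      have := hmin ((w.take m).append ((w.drop n).copy heq.symm rfl)) (by
        intro x hx
        rw [Walk.mem_support_append_iff] at hx
        rcases hx with hx | hx
        · exact hw x (sl_take_sub _ _ hx)
        · rw [Walk.support_copy] at hx
          exact hw x (sl_drop_sub _ _ hx))
      simp [Walk.take_length, Walk.drop_length] at this
      omega
    intro m hm n hn heq
    rcases lt_trichotomy m n with hlt | hlt | hlt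
    · exact absurd heq (key m n hlt hn)
    · exact hlt
    · exact absurd heq.symm (key n m hlt hm)
  · have key : ∀ m n, m + 1 < n → n ≤ w.length → ¬ G.Adj (w.getVert m) (w.getVert n) := by
      intro m n hmn hn hadj
      have := hmin ((w.take m).append (Walk.cons hadj (w.drop n))) (by
        intro x hx
        rw [Walk.mem_support_append_iff] at hx
        rcases hx with hx | hx
        · exact hw x (sl_take_sub _ _ hx)
        · rw [Walk.support_cons, List.mem_cons] at hx
          rcases hx with rfl | hx
          · exact hw _ (Walk.getVert_mem_support _ _)
          · exact hw x (sl_drop_sub _ _ hx))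
      simp [Walk.take_length, Walk.drop_length] at this
      omega
    intro m hm n hn
    simp only [Set.mem_Iic] at hm hn
    constructor
    · intro hadj
      by_contra hcon
      rcases lt_trichotomy m n with hlt | hlt | hlt
      · exact key m n (by omega) hn hadj
      · subst hlt; exact G.loopless.irrefl _ hadj
      · exact key n m (by omega) hm hadj.symm
    · rintro (rfl | rfl)
      · exact w.adj_getVert_succ (by omega)
      · exact (w.adj_getVert_succ (by omega)).symm

/-- A connected set, avoiding `C`, every vertex of which sees at most one vertex of `C`,
and which sees all of `C`. -/
def SLNice {V : Type*} (G : SimpleGraph V) (C : Finset V) (X : Set V) : Prop :=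
  (G.induce X).Connected ∧ (∀ x ∈ X, x ∉ C) ∧
    (∀ x ∈ X, ∀ c ∈ C, ∀ d ∈ C, G.Adj x c → G.Adj x d → c = d) ∧
    ∀ c ∈ C, ∃ x ∈ X, G.Adj x c

lemma SLNice.mono {V : Type*} {G : SimpleGraph V} {C C' : Finset V} {X : Set V}
    (h : SLNice G C X) (hC : C' ⊆ C) : SLNice G C' X :=
  ⟨h.1, fun x hx hc => h.2.1 x hx (hC hc),
    fun x hx c hc d hd => h.2.2.1 x hx c (hC hc) d (hC hd), fun c hc => h.2.2.2 c (hC hc)⟩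

/-- One arm of the creature. -/
lemma sl_arm {V : Type*} {G : SimpleGraph V} {C : Finset V} {D : Set V} (h : SLNice G C D)
    {i j : V} (hi : i ∈ C) (hj : j ∈ C) (hij : i ≠ j) :
    ∃ (x y : V) (T : Set V), x ∈ D ∧ y ∈ D ∧ T ⊆ D ∧ G.Adj x i ∧ ¬ G.Adj x j ∧ ¬ G.Adj y i ∧
      (∀ t ∈ T, ¬ G.Adj t i) ∧ G.Adj x y ∧ x ∉ T ∧ y ∉ T ∧ (∀ t ∈ T, ¬ G.Adj x t) ∧
      (G.induce (insert j T)).Connected ∧ ∃ b ∈ insert j T, G.Adj y b := by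
  classical
  obtain ⟨hconn, hCd, huniq, hsee⟩ := h
  obtain ⟨x0, hx0, hx0i⟩ := hsee i hi
  obtain ⟨z, hz, hzj⟩ := hsee j hj
  obtain ⟨w, hw, hp⟩ := sl_shortest hconn hx0 hz
  have hmem : ∀ n, w.getVert n ∈ D := fun n => hw _ (w.getVert_mem_support n)
  have hex : ∃ n, n ≤ w.length ∧ G.Adj (w.getVert n) j :=
    ⟨w.length, le_rfl, by rw [Walk.getVert_length]; exact hzj⟩
  obtain ⟨n', hn', hn'min⟩ : ∃ n', (n' ≤ w.length ∧ G.Adj (w.getVert n') j) ∧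
      ∀ m, m < n' → ¬ (m ≤ w.length ∧ G.Adj (w.getVert m) j) :=
    ⟨Nat.find hex, Nat.find_spec hex, fun m hm => Nat.find_min hex hm⟩
  have hn0 : G.Adj (w.getVert 0) i := by rw [Walk.getVert_zero]; exact hx0i
  obtain ⟨n, ⟨hnle, hni⟩, hnmax⟩ : ∃ n, (n ≤ n' ∧ G.Adj (w.getVert n) i) ∧
      ∀ m, n < m → m ≤ n' → ¬ G.Adj (w.getVert m) i := by
    refine ⟨Nat.findGreatest (fun m => G.Adj (w.getVert m) i) n', ⟨Nat.findGreatest_le _, ?_⟩, ?_⟩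
    · exact Nat.findGreatest_spec (P := fun m => G.Adj (w.getVert m) i) (Nat.zero_le n') hn0
    · intro m hm hm'
      exact Nat.findGreatest_is_greatest hm hm'
  have hne : n ≠ n' := by
    rintro rfl
    exact hij (huniq _ (hmem n) i hi j hj hni hn'.2)
  have hlt : n < n' := lt_of_le_of_ne hnle hne
  have hJ : Set.Icc (n + 2) n' ⊆ Set.Iic w.length := fun m hm => hm.2.trans hn'.1
  have hpJ := hp.mono hJ Set.ordConnected_Icc
  refine ⟨w.getVert n, w.getVert (n + 1), w.getVert '' Set.Icc (n + 2) n', hmem _, hmem _, ?_, hni,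
    ?_, ?_, ?_, ?_, ?_, ?_, ?_, ?_, ?_⟩
  · rintro _ ⟨m, -, rfl⟩; exact hmem m
  · intro hadj; exact hij (huniq _ (hmem n) i hi j hj hni hadj)
  · exact hnmax _ (by omega) (by omega)
  · rintro _ ⟨m, hm, rfl⟩; exact hnmax _ (by have := hm.1; omega) hm.2
  · exact (hp.2.2 n (by simp; omega) (n + 1) (by simp; omega)).2 (Or.inl rfl)
  · rintro ⟨m, hm, heq⟩
    have := hp.2.1 m (hJ hm) n (by simp; omega) heq
    have := hm.1; omega
  · rintro ⟨m, hm, heq⟩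
    have := hp.2.1 m (hJ hm) (n + 1) (by simp; omega) heq
    have := hm.1; omega
  · rintro _ ⟨m, hm, rfl⟩ hadj
    have := (hp.2.2 n (by simp; omega) m (hJ hm)).1 hadj
    have := hm.1; omega
  · by_cases hemp : n + 2 ≤ n'
    · have hc := hpJ.connected ⟨n', hemp, le_rfl⟩
      have hc2 : (G.induce ({j} : Set V)).Connected :=
        sl_conn_of_walks j rfl (by rintro v rfl; exact ⟨Walk.nil, by simp⟩)
      have := connected_induce_union (G := G) (s := {j}) (t := w.getVert '' Set.Icc (n + 2) n')
        (v := j) (w := w.getVert n') hc2.preconnected hc.preconnected rfl ⟨n', ⟨hemp, le_rfl⟩, rfl⟩ hn'.2.symm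
      rwa [Set.singleton_union] at this
    · have : Set.Icc (n + 2) n' = ∅ := Set.Icc_eq_empty hemp
      rw [this, Set.image_empty]
      exact sl_conn_of_walks j (by simp) (by
        rintro v hv
        have : v = j := by simpa using hv
        subst this; exact ⟨Walk.nil, by simp⟩)
  · by_cases hemp : n + 2 ≤ n'
    · refine ⟨w.getVert (n + 2), Or.inr ⟨n + 2, ⟨le_rfl, hemp⟩, rfl⟩, ?_⟩
      exact (hp.2.2 (n + 1) (by simp; omega) (n + 2) (by simp; omega)).2 (Or.inl rfl)
    · have : n + 1 = n' := by omega
      exact ⟨j, Or.inl rfl, by rw [this]; exact hn'.2⟩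

/-- `k` pairwise anticomplete sets seeing the same two vertices give a creature. -/
lemma sl_creature {V : Type*} {G : SimpleGraph V} {k : ℕ} (hk : 1 ≤ k) {C : Finset V}
    (hind : ∀ a ∈ C, ∀ b ∈ C, ¬ G.Adj a b) {i j : V} (hi : i ∈ C) (hj : j ∈ C) (hij : i ≠ j)
    (D : Fin k → Set V) (hD : ∀ l, SLNice G C (D l))
    (hanti : ∀ l l', l ≠ l' → SLAnti G (D l) (D l')) : ¬ CreatureFree G k := by
  intro hfree
  choose x y T hxD hyD hTD hxi hxj hyi hTi hxy hxT hyT hxTa hconn hyb using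
    fun l => sl_arm (hD l) hi hj hij
  have hDC : ∀ l, ∀ v ∈ D l, v ∉ C := fun l => (hD l).2.1
  have hdisj : ∀ l l' v, v ∈ D l → v ∈ D l' → l = l' := by
    intro l l' v hv hv'
    by_contra hne
    exact Set.disjoint_left.1 (hanti l l' hne).1 hv hv'
  have hadjD : ∀ l l' v v', v ∈ D l → v' ∈ D l' → G.Adj v v' → l = l' := by
    intro l l' v v' hv hv' hadj
    by_contra hne
    exact (hanti l l' hne).2 v hv v' hv' hadj
  let l0 : Fin k := ⟨0, hk⟩
  have hiD : ∀ l v, v ∈ D l → v ≠ i := fun l v hv h => hDC l v hv (h ▸ hi)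
  have hjD : ∀ l v, v ∈ D l → v ≠ j := fun l v hv h => hDC l v hv (h ▸ hj)
  have hxyne : ∀ l l', x l ≠ y l' := by
    intro l l' h
    have hl : l = l' := hdisj l l' (x l) (hxD l) (h ▸ hyD l')
    subst hl
    exact G.loopless.irrefl (x l) (by simpa [← h] using hxy l)
  have hBmem : ∀ b, b ∈ (insert j (⋃ l, T l) : Set V) ↔ b = j ∨ ∃ l, b ∈ T l := by
    intro b; simp
  refine hfree {i} (insert j (⋃ l, T l)) (Set.range x) (Set.range y)
    ⟨⟨i, rfl⟩, ⟨j, Or.inl rfl⟩, ⟨x l0, l0, rfl⟩, ⟨y l0, l0, rfl⟩, ?_, ?_, ?_, ?_, ?_, ?_, ?_, ?_,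
      ?_, ?_, ?_, ?_, x, y, ?_, ?_, rfl, rfl, ?_⟩
  · rw [Set.disjoint_left]
    rintro a rfl hb
    rcases (hBmem _).1 hb with h | ⟨l, h⟩
    · exact hij h
    · exact hiD l _ (hTD l h) rfl
  · rw [Set.disjoint_left]
    rintro a rfl ⟨l, h⟩
    exact hiD l _ (hxD l) h
  · rw [Set.disjoint_left]
    rintro a rfl ⟨l, h⟩
    exact hiD l _ (hyD l) h
  · rw [Set.disjoint_left]
    rintro _ hb ⟨l, rfl⟩
    rcases (hBmem _).1 hb with h | ⟨l', h⟩
    · exact hjD l _ (hxD l) h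
    · have := hdisj l l' _ (hxD l) (hTD l' h)
      subst this; exact hxT l h
  · rw [Set.disjoint_left]
    rintro _ hb ⟨l, rfl⟩
    rcases (hBmem _).1 hb with h | ⟨l', h⟩
    · exact hjD l _ (hyD l) h
    · have := hdisj l l' _ (hyD l) (hTD l' h)
      subst this; exact hyT l h
  · rw [Set.disjoint_left]
    rintro _ ⟨l, rfl⟩ ⟨l', h⟩
    exact hxyne l l' h.symm
  · exact sl_conn_of_walks i rfl (by rintro v rfl; exact ⟨Walk.nil, by simp⟩)
  · refine sl_conn_of_walks j (Or.inl rfl) ?_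
    intro v hv
    rcases (hBmem _).1 hv with rfl | ⟨l, h⟩
    · exact ⟨Walk.nil, by simp⟩
    · obtain ⟨w, hw⟩ := sl_walk_of_conn (hconn l) (Or.inl rfl : j ∈ insert j (T l)) (Or.inr h)
      refine ⟨w, fun z hz => ?_⟩
      rw [hBmem]
      rcases hw z hz with h | h
      · exact Or.inl h
      · exact Or.inr ⟨l, h⟩
  · rintro a rfl w (⟨l, rfl⟩ | hb) hadj
    · exact hyi l hadj.symm
    · rcases (hBmem _).1 hb with rfl | ⟨l, h⟩
      · exact hind _ hi _ hj hadj
      · exact hTi l _ h hadj.symm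
  · rintro b hb w (rfl | ⟨l, rfl⟩) hadj
    · rcases (hBmem _).1 hb with rfl | ⟨l, h⟩
      · exact hind _ hj _ hi hadj
      · exact hTi l _ h hadj
    · rcases (hBmem _).1 hb with rfl | ⟨l', h⟩
      · exact hxj l hadj.symm
      · have := hadjD l l' _ _ (hxD l) (hTD l' h) hadj.symm
        subst this
        exact hxTa l _ h hadj.symm
  · rintro _ ⟨l, rfl⟩
    exact ⟨i, rfl, hxi l⟩
  · rintro _ ⟨l, rfl⟩
    obtain ⟨b, hb, hadj⟩ := hyb l
    refine ⟨b, (hBmem b).2 ?_, hadj⟩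
    rcases hb with h | h
    · exact Or.inl h
    · exact Or.inr ⟨l, h⟩
  · intro l l' h
    exact hdisj l l' _ (hxD l) (h ▸ hxD l')
  · intro l l' h
    exact hdisj l l' _ (hyD l) (h ▸ hyD l')
  · intro l l'
    constructor
    · exact hadjD l l' _ _ (hxD l) (hyD l')
    · rintro rfl; exact hxy l

open Classical in
/-- Cut a word into blocks with a bounded number of fresh letters each. -/
lemma sl_blocks {V : Type*} {W : ℕ → V → Prop} {J : Set ℕ} {C : Finset V} {m b : ℕ} (hb : 0 < b)
    (hcard : C.card ≤ m * b) (hocc : ∀ c ∈ C, ∃ n ∈ J, W n c)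
    (huniq : ∀ n ∈ J, ∀ c ∈ C, ∀ d ∈ C, W n c → W n d → c = d) :
    ∃ (β : ℕ → ℕ) (f : V → ℕ), Monotone β ∧
      (∀ c ∈ C, f c ∈ J ∧ W (f c) c ∧ ∀ n ∈ J, W n c → f c ≤ n) ∧
      (∀ c ∈ C, β (f c) < m) ∧ (∀ t, (C.filter (fun c => β (f c) = t)).card ≤ b) ∧
      ∀ n, β n < β (n + 1) → ∃ c ∈ C, f c = n + 1 := by
  have hf : ∀ c, ∃ n, c ∈ C → (n ∈ J ∧ W n c ∧ ∀ n' ∈ J, W n' c → n ≤ n') := by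
    intro c
    by_cases hc : c ∈ C
    · have hex : ∃ n, n ∈ J ∧ W n c := hocc c hc
      exact ⟨Nat.find hex, fun _ => ⟨(Nat.find_spec hex).1, (Nat.find_spec hex).2,
        fun n' h1 h2 => Nat.find_min' hex ⟨h1, h2⟩⟩⟩
    · exact ⟨0, fun h => absurd h hc⟩
  choose f hf using hf
  let lam : ℕ → ℕ := fun n => (C.filter (fun c => f c ≤ n)).card
  have hlam : Monotone lam := by
    intro n n' h
    apply Finset.card_le_card
    intro c hc
    simp only [Finset.mem_filter] at hc ⊢
    exact ⟨hc.1, hc.2.trans h⟩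
  have hlampos : ∀ c ∈ C, 1 ≤ lam (f c) := by
    intro c hc
    exact Finset.card_pos.2 ⟨c, by simp [hc]⟩
  have hlamle : ∀ n, lam n ≤ m * b := fun n => (Finset.card_filter_le _ _).trans hcard
  have hinj : ∀ c ∈ C, ∀ d ∈ C, f c < f d → lam (f c) < lam (f d) := by
    intro c hc d hd hlt
    apply Finset.card_lt_card
    rw [Finset.ssubset_iff_of_subset]
    · exact ⟨d, by simp [hd], by simp [hlt]⟩
    · intro e he
      simp only [Finset.mem_filter] at he ⊢
      exact ⟨he.1, he.2.trans hlt.le⟩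
  have hfinj : ∀ c ∈ C, ∀ d ∈ C, f c = f d → c = d := by
    intro c hc d hd h
    exact huniq (f c) (hf c hc).1 c hc d hd (hf c hc).2.1 (h ▸ (hf d hd).2.1)
  refine ⟨fun n => (lam n - 1) / b, f, ?_, hf, ?_, ?_, ?_⟩
  · intro n n' h
    exact Nat.div_le_div_right (Nat.sub_le_sub_right (hlam h) 1)
  · intro c hc
    rw [Nat.div_lt_iff_lt_mul hb]
    have := hlampos c hc
    have := hlamle (f c)
    omega
  · intro t
    have : (C.filter (fun c => (lam (f c) - 1) / b = t)).card ≤ (Finset.Ico (t * b) (t * b + b)).card := by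
      apply Finset.card_le_card_of_injOn (fun c => lam (f c) - 1)
      · intro c hc
        simp only [Finset.coe_filter, Set.mem_ofPred_eq] at hc
        simp only [Finset.coe_Ico, Set.mem_Ico]
        rw [Nat.div_eq_iff hb] at hc
        omega
      · intro c hc d hd h
        simp only [Finset.coe_filter, Set.mem_ofPred_eq] at hc hd h
        have h1 := hlampos c hc.1
        have h2 := hlampos d hd.1
        rcases lt_trichotomy (f c) (f d) with hlt | hlt | hlt
        · have := hinj c hc.1 d hd.1 hlt; omega
        · exact hfinj c hc.1 d hd.1 hlt
        · have := hinj d hd.1 c hc.1 hlt; omega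
    simpa using this
  · intro n hn
    by_contra hcon
    push Not at hcon
    have : lam (n + 1) = lam n := by
      apply congrArg Finset.card
      ext c
      simp only [Finset.mem_filter]
      constructor
      · rintro ⟨hc, h⟩
        have := hcon c hc
        exact ⟨hc, by omega⟩
      · rintro ⟨hc, h⟩
        exact ⟨hc, by omega⟩
    simp [this] at hn

/-- Splitting a path into two anticomplete pieces that both see the bad vertices. -/
lemma sl_split {V : Type*} {G : SimpleGraph V} {p : ℕ → V} {J : Set ℕ} {C C' : Finset V}
    (hp : SLPath G p J) (hn : SLNice G C (p '' J)) {β : ℕ → ℕ} {f : V → ℕ} (hβ : Monotone β)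
    (hf : ∀ c ∈ C, f c ∈ J ∧ G.Adj (p (f c)) c)
    (hjump : ∀ n, β n < β (n + 1) → ∃ c ∈ C, f c = n + 1) (t : ℕ) (hC' : C' ⊆ C)
    (hne : C'.Nonempty)
    (hbad : ∀ c ∈ C', β (f c) = t ∧ ∃ n ∈ J, G.Adj (p n) c ∧ t < β n) :
    ∃ J1 J2 : Set ℕ, J1 ⊆ J ∧ J2 ⊆ J ∧ SLPath G p J1 ∧ SLPath G p J2 ∧
      SLNice G C' (p '' J1) ∧ SLNice G C' (p '' J2) ∧ SLAnti G (p '' J1) (p '' J2) := by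
  have hJ1 : ({n | n ∈ J ∧ β n = t} : Set ℕ).OrdConnected := by
    refine ⟨?_⟩
    rintro a ⟨ha, ha'⟩ b ⟨hb, hb'⟩ c ⟨hac, hcb⟩
    have h1 := hβ hac
    have h2 := hβ hcb
    exact ⟨hp.1.out ha hb ⟨hac, hcb⟩, by omega⟩
  have hJ2 : ({n | n ∈ J ∧ t < β (n - 1)} : Set ℕ).OrdConnected := by
    refine ⟨?_⟩
    rintro a ⟨ha, ha'⟩ b ⟨hb, hb'⟩ c ⟨hac, hcb⟩
    have h1 := hβ (Nat.sub_le_sub_right hac 1)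
    exact ⟨hp.1.out ha hb ⟨hac, hcb⟩, by omega⟩
  have hs1 : {n | n ∈ J ∧ β n = t} ⊆ J := fun n h => h.1
  have hs2 : {n | n ∈ J ∧ t < β (n - 1)} ⊆ J := fun n h => h.1
  have hp1 := hp.mono hs1 hJ1
  have hp2 := hp.mono hs2 hJ2
  have hsee1 : ∀ c ∈ C', f c ∈ {n | n ∈ J ∧ β n = t} := fun c hc => ⟨(hf c (hC' hc)).1, (hbad c hc).1⟩
  have hsee2 : ∀ c ∈ C', ∃ n ∈ {n | n ∈ J ∧ t < β (n - 1)}, G.Adj (p n) c := by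
    intro c hc
    obtain ⟨h0, n, hnJ, hadj, hlt⟩ := hbad c hc
    refine ⟨n, ⟨hnJ, ?_⟩, hadj⟩
    by_contra hcon
    rcases n with _ | n
    · simp at hcon; omega
    · simp only [Nat.add_sub_cancel] at hcon
      obtain ⟨d, hd, hfd⟩ := hjump n (by omega)
      have : d = c := hn.2.2.1 (p (n + 1)) ⟨_, hnJ, rfl⟩ d hd c (hC' hc)
        (hfd ▸ (hf d hd).2) hadj
      subst this
      rw [hfd] at h0
      omega
  obtain ⟨c0, hc0⟩ := hne
  have hsub : ∀ {K : Set ℕ}, K ⊆ J → SLPath G p K → (∀ c ∈ C', ∃ n ∈ K, G.Adj (p n) c) →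
      SLNice G C' (p '' K) := by
    intro K hK hpK hsee
    obtain ⟨n0, hn0, -⟩ := hsee c0 hc0
    refine ⟨hpK.connected ⟨n0, hn0⟩, ?_, ?_, ?_⟩
    · intro x hx hxC
      exact hn.2.1 x (Set.image_mono hK hx) (hC' hxC)
    · intro x hx c hc d hd
      exact hn.2.2.1 x (Set.image_mono hK hx) c (hC' hc) d (hC' hd)
    · intro c hc
      obtain ⟨n, hnK, hadj⟩ := hsee c hc
      exact ⟨p n, ⟨n, hnK, rfl⟩, hadj⟩
  refine ⟨_, _, hs1, hs2, hp1, hp2, hsub hs1 hp1 (fun c hc => ⟨f c, hsee1 c hc, (hf c (hC' hc)).2⟩),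
    hsub hs2 hp2 hsee2, ?_, ?_⟩
  · rw [Set.disjoint_left]
    rintro _ ⟨n, ⟨hnJ, hnt⟩, rfl⟩ ⟨n', ⟨hn'J, hn't⟩, heq⟩
    have := hp.2.1 n' hn'J n hnJ heq
    subst this
    have := hβ (Nat.sub_le n' 1)
    omega
  · rintro _ ⟨n, ⟨hnJ, hnt⟩, rfl⟩ _ ⟨n', ⟨hn'J, hn't⟩, rfl⟩ hadj
    have h1 : n' - 1 ≤ n := by
      rcases (hp.2.2 n hnJ n' hn'J).1 hadj with h | h <;> omega
    have := hβ h1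
    omega

/-- Either a long chain or a bounded rank function. -/
lemma sl_chain {V : Type*} (R : V → V → Prop) (k : ℕ) : ∀ s : Finset V,
    (∃ c : Fin k → V, (∀ i, c i ∈ s) ∧ ∀ i j : Fin k, (i : ℕ) + 1 = j → R (c i) (c j)) ∨
    ∃ h : V → ℕ, (∀ c ∈ s, h c < k) ∧ ∀ c ∈ s, ∀ d ∈ s, R c d → h c < h d := by
  classical
  induction k with
  | zero => intro s; exact Or.inl ⟨fun i => i.elim0, fun i => i.elim0, fun i => i.elim0⟩
  | succ k ih =>
    intro s
    rcases ih (s.filter (fun c => ∃ d ∈ s, R d c)) with ⟨c, hc, hR⟩ | ⟨h, h1, h2⟩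
    · rcases k with _ | k
      · by_cases hs : s.Nonempty
        · obtain ⟨d, hd⟩ := hs
          exact Or.inl ⟨fun _ => d, fun _ => hd, fun i j hij => by omega⟩
        · rw [Finset.not_nonempty_iff_eq_empty] at hs
          subst hs
          exact Or.inr ⟨fun _ => 0, by simp, by simp⟩
      · obtain ⟨d, hd, hdR⟩ := (Finset.mem_filter.1 (hc 0)).2
        refine Or.inl ⟨Fin.cons d c, ?_, ?_⟩
        · intro i
          refine Fin.cases hd (fun i => ?_) i
          exact (Finset.mem_filter.1 (hc i)).1
        · intro i j
          refine Fin.cases ?_ (fun i => ?_) i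
          · refine Fin.cases (by simp) (fun j => ?_) j
            intro hij
            have : j = 0 := by ext; simpa using hij.symm
            subst this
            simpa using hdR
          · refine Fin.cases (by simp) (fun j => ?_) j
            intro hij
            simp only [Fin.cons_succ]
            exact hR i j (by simpa using hij)
    · right
      refine ⟨fun c => if c ∈ s.filter (fun c => ∃ d ∈ s, R d c) then h c + 1 else 0, ?_, ?_⟩
      · intro c hc
        simp only
        split_ifs with hh
        · have := h1 c hh; omega
        · omega
      · intro c hc d hd hR
        have hd' : d ∈ s.filter (fun c => ∃ d ∈ s, R d c) := Finset.mem_filter.2 ⟨hd, c, hc, hR⟩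
        simp only [hd', if_true]
        split_ifs with hh
        · have := h2 c hh d hd' hR; omega
        · omega

lemma sl_strictMono {k : ℕ} {g : Fin k → ℕ} (h : ∀ i j : Fin k, (i : ℕ) + 1 = j → g i < g j) :
    StrictMono g := by
  have key : ∀ d : ℕ, ∀ i j : Fin k, (i : ℕ) + d + 1 = j → g i < g j := by
    intro d
    induction d with
    | zero => intro i j hij; exact h i j (by omega)
    | succ d ih =>
      intro i j hij
      have hj := j.2
      let j' : Fin k := ⟨j - 1, by omega⟩
      exact (ih i j' (by simp only [j']; omega)).trans (h j' j (by simp only [j']; omega))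
  intro i j hij
  have : (i : ℕ) < j := hij
  exact key (j - i - 1) i j (by omega)

lemma sl_strictAnti {k : ℕ} {g : Fin k → ℕ} (h : ∀ i j : Fin k, (i : ℕ) + 1 = j → g j < g i) :
    StrictAnti g := by
  have key : ∀ d : ℕ, ∀ i j : Fin k, (i : ℕ) + d + 1 = j → g j < g i := by
    intro d
    induction d with
    | zero => intro i j hij; exact h i j (by omega)
    | succ d ih =>
      intro i j hij
      have hj := j.2
      let j' : Fin k := ⟨j - 1, by omega⟩
      exact (h j' j (by simp only [j']; omega)).trans (ih i j' (by simp only [j']; omega))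
  intro i j hij
  have : (i : ℕ) < j := hij
  exact key (j - i - 1) i j (by omega)

open Classical in
/-- Erdős–Szekeres in a grid with bounded rows and columns. -/
lemma sl_grid {V : Type*} {s : Finset V} {k b : ℕ} {α β : V → ℕ}
    (hα : ∀ t, (s.filter (fun c => α c = t)).card ≤ b)
    (hβ : ∀ t, (s.filter (fun c => β c = t)).card ≤ b) (hs : k * k * b < s.card) :
    ∃ c : Fin k → V, (∀ i, c i ∈ s) ∧ StrictMono (fun i => α (c i)) ∧
      (StrictMono (fun i => β (c i)) ∨ StrictAnti (fun i => β (c i))) := by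
  rcases sl_chain (fun c d => α c < α d ∧ β c < β d) k s with ⟨c, hc, hR⟩ | ⟨h, hh1, hh2⟩
  · exact ⟨c, hc, sl_strictMono fun i j hij => (hR i j hij).1,
      Or.inl (sl_strictMono fun i j hij => (hR i j hij).2)⟩
  rcases sl_chain (fun c d => α c < α d ∧ β d < β c) k s with ⟨c, hc, hR⟩ | ⟨g, hg1, hg2⟩
  · exact ⟨c, hc, sl_strictMono fun i j hij => (hR i j hij).1,
      Or.inr (sl_strictAnti fun i j hij => (hR i j hij).2)⟩
  exfalso
  obtain ⟨y, -, hy⟩ := Finset.exists_lt_card_fiber_of_mul_lt_card_of_maps_to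
    (s := s) (t := Finset.range k ×ˢ Finset.range k) (f := fun c => (h c, g c)) (n := b)
    (by intro c hc; simp [hh1 c hc, hg1 c hc]) (by simpa using hs)
  have hmem : ∀ c ∈ s.filter (fun c => (h c, g c) = y), c ∈ s ∧ h c = y.1 ∧ g c = y.2 := by
    intro c hc
    rw [Finset.mem_filter] at hc
    exact ⟨hc.1, by rw [← hc.2], by rw [← hc.2]⟩
  have hle : ∀ c ∈ s.filter (fun c => (h c, g c) = y), ∀ d ∈ s.filter (fun c => (h c, g c) = y),
      α c < α d → β c = β d := by
    intro c hc d hd hlt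
    obtain ⟨hcs, hc1, hc2⟩ := hmem c hc
    obtain ⟨hds, hd1, hd2⟩ := hmem d hd
    by_contra hne
    rcases lt_or_gt_of_ne hne with hl | hl
    · have := hh2 c hcs d hds ⟨hlt, hl⟩; omega
    · have := hg2 c hcs d hds ⟨hlt, hl⟩; omega
  have hline : ∀ c ∈ s.filter (fun c => (h c, g c) = y), ∀ d ∈ s.filter (fun c => (h c, g c) = y),
      α c ≠ α d → β c = β d := by
    intro c hc d hd hne
    rcases lt_or_gt_of_ne hne with hl | hl
    · exact hle c hc d hd hl
    · exact (hle d hd c hc hl).symm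
  obtain ⟨c0, hc0⟩ := Finset.card_pos.1 (Nat.zero_lt_of_lt hy)
  by_cases hall : ∀ c ∈ s.filter (fun c => (h c, g c) = y), α c = α c0
  · have : s.filter (fun c => (h c, g c) = y) ⊆ s.filter (fun c => α c = α c0) := by
      intro c hc
      exact Finset.mem_filter.2 ⟨(hmem c hc).1, hall c hc⟩
    have := (Finset.card_le_card this).trans (hα (α c0))
    omega
  · push Not at hall
    obtain ⟨d, hd, hdne⟩ := hall
    have hdb := hline d hd c0 hc0 hdne
    have : s.filter (fun c => (h c, g c) = y) ⊆ s.filter (fun c => β c = β c0) := by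
      intro c hc
      refine Finset.mem_filter.2 ⟨(hmem c hc).1, ?_⟩
      by_cases hca : α c = α c0
      · rw [← hdb]; exact hline c hc d hd (by omega)
      · exact hline c hc c0 hc0 hca
    have := (Finset.card_le_card this).trans (hβ (β c0))
    omega

/-- One rail of the ladder. -/
lemma sl_rail {V : Type*} {G : SimpleGraph V} {p : ℕ → V} {J : Set ℕ}
    (hp : SLPath G p J) {β : ℕ → ℕ} {f : V → ℕ} (hβ : Monotone β) {k : ℕ} (c : Fin k → V)
    (hf : ∀ i, f (c i) ∈ J ∧ G.Adj (p (f (c i))) (c i))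
    (hgood : ∀ i, ∀ n ∈ J, G.Adj (p n) (c i) → β n = β (f (c i)))
    (hmono : StrictMono (fun i => β (f (c i)))) :
    ∃ B : Fin k → Set V, (∀ i, (B i).Nonempty) ∧ (∀ i, (G.induce (B i)).Connected) ∧
      (∀ i j, i ≠ j → Disjoint (B i) (B j)) ∧ (∀ i, B i ⊆ p '' J) ∧
      (∀ i j, i ≠ j → ((∃ a ∈ B i, ∃ b ∈ B j, G.Adj a b) ↔
        ((i : ℕ) + 1 = j ∨ (j : ℕ) + 1 = i))) ∧
      ∀ i j, (∃ a ∈ B i, G.Adj a (c j)) ↔ i = j := by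
  classical
  let idx : ℕ → ℕ := fun n => (Finset.univ.filter (fun i : Fin k => β (f (c i)) < β n)).card
  have hidx : Monotone idx := by
    intro n n' h
    apply Finset.card_le_card
    intro i hi
    simp only [Finset.mem_filter, Finset.mem_univ, true_and] at hi ⊢
    exact hi.trans_le (hβ h)
  have hidxc : ∀ i n, β n = β (f (c i)) → idx n = i := by
    intro i n hn
    have : (Finset.univ.filter (fun j : Fin k => β (f (c j)) < β n)) = Finset.Iio i := by
      ext j
      simp only [Finset.mem_filter, Finset.mem_univ, true_and, Finset.mem_Iio, hn]
      exact hmono.lt_iff_lt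
    simp only [idx, this, Fin.card_Iio]
  have hJ : ∀ i, ({n | n ∈ J ∧ idx n = i} : Set ℕ).OrdConnected := by
    intro i
    refine ⟨?_⟩
    rintro a ⟨ha, ha'⟩ b ⟨hb, hb'⟩ d ⟨hac, hcb⟩
    have h1 := hidx hac
    have h2 := hidx hcb
    exact ⟨hp.1.out ha hb ⟨hac, hcb⟩, by omega⟩
  have hsub : ∀ i, {n | n ∈ J ∧ idx n = i} ⊆ J := fun i n h => h.1
  have hfm : ∀ i : Fin k, f (c i) ∈ {n | n ∈ J ∧ idx n = i} := fun i => ⟨(hf i).1, hidxc i _ rfl⟩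
  have hstep : ∀ i j : Fin k, i < j → ∀ n ∈ J, ∀ n' ∈ J, idx n = i → idx n' = j →
      G.Adj (p n) (p n') → (i : ℕ) + 1 = j := by
    intro i j hij n hn n' hn' h1 h2 hadj
    have hij' : (i : ℕ) < j := hij
    have hlt : n < n' := by
      by_contra hcon
      have := hidx (not_lt.1 hcon)
      omega
    have hsucc : n + 1 = n' := by
      rcases (hp.2.2 n hn n' hn').1 hadj with h | h <;> omega
    by_contra hne
    have hj := j.2
    let l : Fin k := ⟨i + 1, by omega⟩
    have hl := hidxc l (f (c l)) rfl
    have hl' : idx (f (c l)) = i + 1 := hl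
    have h3 : n < f (c l) := by
      by_contra hcon
      have := hidx (not_lt.1 hcon)
      omega
    have h4 : f (c l) < n' := by
      by_contra hcon
      have := hidx (not_lt.1 hcon)
      omega
    omega
  have hedge : ∀ i j : Fin k, (i : ℕ) + 1 = j →
      ∃ n ∈ {n | n ∈ J ∧ idx n = i}, ∃ n' ∈ {n | n ∈ J ∧ idx n = j}, G.Adj (p n) (p n') := by
    intro i j hij
    obtain ⟨hi1, hi2⟩ := hfm i
    obtain ⟨hj1, hj2⟩ := hfm j
    have hex : ∃ n, (j : ℕ) ≤ idx n := ⟨f (c j), hj2.ge⟩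
    obtain ⟨n, hn, hnmin⟩ : ∃ n, (j : ℕ) ≤ idx n ∧ ∀ m < n, ¬ (j : ℕ) ≤ idx m :=
      ⟨Nat.find hex, Nat.find_spec hex, fun m hm => Nat.find_min hex hm⟩
    have h1 : n ≤ f (c j) := by
      by_contra hcon
      exact hnmin _ (not_le.1 hcon) hj2.ge
    have h2 : f (c i) < n := by
      by_contra hcon
      have := hidx (not_lt.1 hcon)
      omega
    have h3 := hidx h1
    obtain ⟨m, rfl⟩ : ∃ m, n = m + 1 := ⟨n - 1, by omega⟩
    have h4 := hnmin m (by omega)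
    have h5 := hidx (show f (c i) ≤ m by omega)
    have hmJ : m ∈ J := hp.1.out hi1 hj1 ⟨by omega, by omega⟩
    have hmJ' : m + 1 ∈ J := hp.1.out hi1 hj1 ⟨by omega, by omega⟩
    exact ⟨m, ⟨hmJ, by omega⟩, m + 1, ⟨hmJ', by omega⟩, (hp.2.2 m hmJ _ hmJ').2 (Or.inl rfl)⟩
  refine ⟨fun i => p '' {n | n ∈ J ∧ idx n = i}, ?_, ?_, ?_, ?_, ?_, ?_⟩
  · intro i; exact ⟨_, _, hfm i, rfl⟩
  · intro i; exact (hp.mono (hsub i) (hJ i)).connected ⟨_, hfm i⟩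
  · intro i j hij
    rw [Set.disjoint_left]
    rintro _ ⟨n, ⟨hn, hni⟩, rfl⟩ ⟨n', ⟨hn', hnj⟩, heq⟩
    have := hp.2.1 n' hn' n hn heq
    subst this
    exact hij (Fin.ext (by omega))
  · intro i; exact Set.image_mono (hsub i)
  · intro i j hij
    constructor
    · rintro ⟨_, ⟨n, ⟨hn, hni⟩, rfl⟩, _, ⟨n', ⟨hn', hnj⟩, rfl⟩, hadj⟩
      rcases lt_or_gt_of_ne hij with h | h
      · exact Or.inl (hstep i j h n hn n' hn' hni hnj hadj)
      · exact Or.inr (hstep j i h n' hn' n hn hnj hni hadj.symm)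
    · rintro (h | h)
      · obtain ⟨n, hn, n', hn', hadj⟩ := hedge i j h
        exact ⟨_, ⟨n, hn, rfl⟩, _, ⟨n', hn', rfl⟩, hadj⟩
      · obtain ⟨n, hn, n', hn', hadj⟩ := hedge j i h
        exact ⟨_, ⟨n', hn', rfl⟩, _, ⟨n, hn, rfl⟩, hadj.symm⟩
  · intro i j
    constructor
    · rintro ⟨_, ⟨n, ⟨hn, hni⟩, rfl⟩, hadj⟩
      have := hidxc j n (hgood j n hn hadj)
      exact Fin.ext (by omega)
    · rintro rfl
      exact ⟨_, ⟨_, hfm i, rfl⟩, (hf i).2⟩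

/-- One rail of the ladder, in either direction. -/
lemma sl_rail' {V : Type*} {G : SimpleGraph V} {p : ℕ → V} {J : Set ℕ}
    (hp : SLPath G p J) {β : ℕ → ℕ} {f : V → ℕ} (hβ : Monotone β) {k : ℕ} (c : Fin k → V)
    (hf : ∀ i, f (c i) ∈ J ∧ G.Adj (p (f (c i))) (c i))
    (hgood : ∀ i, ∀ n ∈ J, G.Adj (p n) (c i) → β n = β (f (c i)))
    (hmono : StrictMono (fun i => β (f (c i))) ∨ StrictAnti (fun i => β (f (c i)))) :
    ∃ B : Fin k → Set V, (∀ i, (B i).Nonempty) ∧ (∀ i, (G.induce (B i)).Connected) ∧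
      (∀ i j, i ≠ j → Disjoint (B i) (B j)) ∧ (∀ i, B i ⊆ p '' J) ∧
      (∀ i j, i ≠ j → ((∃ a ∈ B i, ∃ b ∈ B j, G.Adj a b) ↔
        ((i : ℕ) + 1 = j ∨ (j : ℕ) + 1 = i))) ∧
      ∀ i j, (∃ a ∈ B i, G.Adj a (c j)) ↔ i = j := by
  rcases hmono with hmono | hmono
  · exact sl_rail hp hβ c hf hgood hmono
  · obtain ⟨B, h1, h2, h3, h4, h5, h6⟩ := sl_rail hp hβ (fun i => c i.rev) (fun i => hf i.rev)
      (fun i => hgood i.rev) (by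
        intro i j hij
        exact hmono (Fin.rev_lt_rev.2 hij))
    refine ⟨fun i => B i.rev, fun i => h1 _, fun i => h2 _, ?_, fun i => h4 _, ?_, ?_⟩
    · intro i j hij
      exact h3 _ _ (fun h => hij (Fin.rev_injective h))
    · intro i j hij
      rw [h5 _ _ (fun h => hij (Fin.rev_injective h))]
      simp only [Fin.val_rev]
      omega
    · intro i j
      have := h6 i.rev j.rev
      simp only [Fin.rev_rev] at this
      rw [this]
      exact Fin.rev_injective.eq_iff

/-- Assembling the ladder. -/
lemma sl_assemble {V : Type*} {G : SimpleGraph V} {X Y : Set V} (hXY : SLAnti G X Y) {k : ℕ}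
    (c : Fin k → V) (hinj : Function.Injective c) (hcX : ∀ i, c i ∉ X) (hcY : ∀ i, c i ∉ Y)
    (hind : ∀ i j, ¬ G.Adj (c i) (c j))
    (hX : ∃ B : Fin k → Set V, (∀ i, (B i).Nonempty) ∧ (∀ i, (G.induce (B i)).Connected) ∧
      (∀ i j, i ≠ j → Disjoint (B i) (B j)) ∧ (∀ i, B i ⊆ X) ∧
      (∀ i j, i ≠ j → ((∃ a ∈ B i, ∃ b ∈ B j, G.Adj a b) ↔
        ((i : ℕ) + 1 = j ∨ (j : ℕ) + 1 = i))) ∧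
      ∀ i j, (∃ a ∈ B i, G.Adj a (c j)) ↔ i = j)
    (hY : ∃ B : Fin k → Set V, (∀ i, (B i).Nonempty) ∧ (∀ i, (G.induce (B i)).Connected) ∧
      (∀ i j, i ≠ j → Disjoint (B i) (B j)) ∧ (∀ i, B i ⊆ Y) ∧
      (∀ i j, i ≠ j → ((∃ a ∈ B i, ∃ b ∈ B j, G.Adj a b) ↔
        ((i : ℕ) + 1 = j ∨ (j : ℕ) + 1 = i))) ∧
      ∀ i j, (∃ a ∈ B i, G.Adj a (c j)) ↔ i = j) :
    IsInducedMinor (skinnyLadder k) G := by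
  obtain ⟨P, p1, p2, p3, p4, p5, p6⟩ := hX
  obtain ⟨Q, q1, q2, q3, q4, q5, q6⟩ := hY
  have hPQd : ∀ i j, Disjoint (P i) (Q j) := fun i j => hXY.1.mono (p4 i) (q4 j)
  have hPQe : ∀ i j, ¬ ∃ a ∈ P i, ∃ b ∈ Q j, G.Adj a b := by
    rintro i j ⟨a, ha, b, hb, hadj⟩
    exact hXY.2 a (p4 i ha) b (q4 j hb) hadj
  have hQPe : ∀ i j, ¬ ∃ a ∈ Q i, ∃ b ∈ P j, G.Adj a b := by
    rintro i j ⟨a, ha, b, hb, hadj⟩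
    exact hXY.2 b (p4 j hb) a (q4 i ha) hadj.symm
  have hPc : ∀ i j, Disjoint (P i) {c j} := fun i j =>
    Set.disjoint_singleton_right.2 (fun h => hcX j (p4 i h))
  have hQc : ∀ i j, Disjoint (Q i) {c j} := fun i j =>
    Set.disjoint_singleton_right.2 (fun h => hcY j (q4 i h))
  have p6' : ∀ i j, (∃ a, a ∈ P i ∧ G.Adj (c j) a) ↔ i = j := by
    intro i j; rw [← p6 i j]; simp only [G.adj_comm]
  have q6' : ∀ i j, (∃ a, a ∈ Q i ∧ G.Adj (c j) a) ↔ i = j := by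
    intro i j; rw [← q6 i j]; simp only [G.adj_comm]
  refine ⟨fun h => (![P h.2, Q h.2, {c h.2}] : Fin 3 → Set V) h.1, ?_, ?_, ?_, ?_⟩
  · rintro ⟨a, i⟩
    fin_cases a
    · exact p1 i
    · exact q1 i
    · exact ⟨c i, rfl⟩
  · rintro ⟨a, i⟩
    fin_cases a
    · exact p2 i
    · exact q2 i
    · exact sl_conn_of_walks (c i) rfl (by rintro v rfl; exact ⟨Walk.nil, by simp⟩)
  · rintro ⟨a, i⟩ ⟨b, j⟩ hne
    fin_cases a <;> fin_cases b
    · exact p3 i j (fun h => hne (by rw [h]))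
    · exact hPQd i j
    · exact hPc i j
    · exact (hPQd j i).symm
    · exact q3 i j (fun h => hne (by rw [h]))
    · exact hQc i j
    · exact (hPc j i).symm
    · exact (hQc j i).symm
    · refine Set.disjoint_singleton.2 (fun h => hne ?_)
      have hij : i = j := hinj h
      rw [hij]
  · rintro ⟨a, i⟩ ⟨b, j⟩ hne
    fin_cases a <;> fin_cases b
    · have hij : i ≠ j := fun h => hne (by rw [h])
      refine (p5 i j hij).trans ?_
      simp [skinnyLadder, hij]
    · refine (iff_false_left (hPQe i j)).2 ?_
      simp [skinnyLadder]
    · simp [skinnyLadder, p6 i j]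
    · refine (iff_false_left (hQPe i j)).2 ?_
      simp [skinnyLadder]
    · have hij : i ≠ j := fun h => hne (by rw [h])
      refine (q5 i j hij).trans ?_
      simp [skinnyLadder, hij]
    · simp [skinnyLadder, q6 i j]
    · simp [skinnyLadder, p6' j i]
    · simp [skinnyLadder, q6' j i]
    · simp [skinnyLadder, hind i j]

lemma sl_pathcase {V : Type*} {G : SimpleGraph V} {p : ℕ → V} {J : Set ℕ} {C : Finset V} {m q : ℕ}
    (hq : 1 ≤ q) (hp : SLPath G p J) (hn : SLNice G C (p '' J)) (hcard : C.card = m * (4 * q)) :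
    (∃ C' ⊆ C, C'.card = q ∧ ∃ J1 J2 : Set ℕ, J1 ⊆ J ∧ J2 ⊆ J ∧ SLPath G p J1 ∧ SLPath G p J2 ∧
      SLNice G C' (p '' J1) ∧ SLNice G C' (p '' J2) ∧ SLAnti G (p '' J1) (p '' J2)) ∨
    ∃ (β : ℕ → ℕ) (f : V → ℕ) (Bad : Finset V), Monotone β ∧
      (∀ c ∈ C, f c ∈ J ∧ G.Adj (p (f c)) c) ∧
      (∀ (t : ℕ) (s : Finset V), s ⊆ C → (∀ c ∈ s, β (f c) = t) → s.card ≤ 4 * q) ∧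
      Bad.card ≤ m * (q - 1) ∧
      ∀ c ∈ C, c ∉ Bad → ∀ n ∈ J, G.Adj (p n) c → β n = β (f c) := by
  classical
  obtain ⟨β, f, hβ, hf, hm, hfib, hjump⟩ := sl_blocks (W := fun n c => G.Adj (p n) c) (J := J)
    (C := C) (m := m) (b := 4 * q) (by omega) hcard.le
    (by
      intro c hc
      obtain ⟨_, ⟨n, hn, rfl⟩, hadj⟩ := hn.2.2.2 c hc
      exact ⟨n, hn, hadj⟩)
    (by
      intro n hnJ c hc d hd h1 h2
      exact hn.2.2.1 _ ⟨n, hnJ, rfl⟩ c hc d hd h1 h2)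
  by_cases hbig : m * (q - 1) < (C.filter (fun c => ∃ n ∈ J, G.Adj (p n) c ∧ β (f c) < β n)).card
  · left
    obtain ⟨t, -, ht⟩ := Finset.exists_lt_card_fiber_of_mul_lt_card_of_maps_to
      (s := C.filter (fun c => ∃ n ∈ J, G.Adj (p n) c ∧ β (f c) < β n))
      (t := Finset.range m) (f := fun c => β (f c)) (n := q - 1)
      (by intro c hc; simpa using hm c (Finset.mem_filter.1 hc).1) (by simpa using hbig)
    obtain ⟨C', hC', hC'card⟩ := Finset.exists_subset_card_eq (n := q) (Nat.le_of_pred_lt ht)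
    have hmem : ∀ c ∈ C', c ∈ C ∧ β (f c) = t ∧ ∃ n ∈ J, G.Adj (p n) c ∧ t < β n := by
      intro c hc
      have := hC' hc
      simp only [Finset.mem_filter] at this
      obtain ⟨⟨h1, n, h2, h3, h4⟩, h5⟩ := this
      exact ⟨h1, h5, n, h2, h3, by omega⟩
    refine ⟨C', fun c hc => (hmem c hc).1, hC'card, ?_⟩
    exact sl_split hp hn hβ (fun c hc => ⟨(hf c hc).1, (hf c hc).2.1⟩) hjump t
      (fun c hc => (hmem c hc).1) (Finset.card_pos.1 (show 0 < C'.card by rw [hC'card]; exact hq)) (fun c hc => (hmem c hc).2)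
  · right
    refine ⟨β, f, _, hβ, fun c hc => ⟨(hf c hc).1, (hf c hc).2.1⟩, ?_, not_lt.1 hbig, ?_⟩
    · intro t s hs hst
      refine le_trans (Finset.card_le_card ?_) (hfib t)
      intro c hc
      exact Finset.mem_filter.2 ⟨hs hc, hst c hc⟩
    · intro c hc hbad n hnJ hadj
      have h1 := hβ ((hf c hc).2.2 n hnJ hadj)
      by_contra hne
      exact hbad (Finset.mem_filter.2 ⟨hc, n, hnJ, hadj, by omega⟩)

lemma sl_main {V : Type*} {G : SimpleGraph V} {k : ℕ} (hk : 1 ≤ k) (hfree : CreatureFree G k) :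
    ∀ (d : ℕ) (p q : ℕ → V) (J L : Set ℕ) (l : List (Set V)) (C : Finset V),
      (∀ a ∈ C, ∀ b ∈ C, ¬ G.Adj a b) → SLPath G p J → SLPath G q L →
      (∀ X ∈ (p '' J) :: (q '' L) :: l, SLNice G C X) →
      ((p '' J) :: (q '' L) :: l).Pairwise (SLAnti G) → k ≤ l.length + 2 + d →
      C.card = 2 * (8 * k ^ 2) ^ d → IsInducedMinor (skinnyLadder k) G := by
  classical
  intro d
  induction d with
  | zero =>
    intro p q J L l C hind hp hq hnice hpair hlen hcard
    exfalso
    simp only [pow_zero, mul_one] at hcard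
    obtain ⟨i, j, hij, rfl⟩ := Finset.card_eq_two.1 hcard
    have hlen' : k ≤ ((p '' J) :: (q '' L) :: l).length := by simp; omega
    refine sl_creature hk hind (i := i) (j := j) (by simp) (by simp) hij
      (fun a => ((p '' J) :: (q '' L) :: l).get (Fin.castLE hlen' a))
      (fun a => hnice _ (List.get_mem _ _)) ?_ hfree
    intro a b hab
    rw [List.pairwise_iff_get] at hpair
    rcases lt_or_gt_of_ne hab with h | h
    · exact hpair _ _ h
    · exact (hpair _ _ h).symm
  | succ d ih =>
    intro p q J L l C hind hp hq hnice hpair hlen hcard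
    have hk2 : 1 ≤ k ^ 2 := Nat.one_le_pow _ _ hk
    obtain ⟨r, hr⟩ : ∃ r, r = 2 * (8 * k ^ 2) ^ d := ⟨_, rfl⟩
    have hr1 : 1 ≤ r := by
      have : 0 < (8 * k ^ 2) ^ d := by positivity
      omega
    have hcard' : C.card = (2 * k ^ 2) * (4 * r) := by rw [hcard, hr]; ring
    have hnP := hnice (p '' J) (by simp)
    have hnQ := hnice (q '' L) (by simp)
    have hnl : ∀ X ∈ l, SLNice G C X := fun X hX => hnice X (by simp [hX])
    simp only [List.pairwise_cons, List.mem_cons, forall_eq_or_imp] at hpair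
    obtain ⟨⟨hPQ, hPl⟩, hQl, hll⟩ := hpair
    rcases sl_pathcase hr1 hp hnP hcard' with
      ⟨C', hC', hC'card, J1, J2, hs1, hs2, hp1, hp2, hn1, hn2, h12⟩ |
      ⟨β, f, Bad, hβ, hf, hfib, hBad, hgood⟩
    · refine ih p q J2 L ((p '' J1) :: l) C' (fun a ha b hb => hind a (hC' ha) b (hC' hb)) hp2 hq
        ?_ ?_ (by simp; omega) (hC'card.trans hr)
      · intro X hX
        simp only [List.mem_cons] at hX
        rcases hX with rfl | rfl | rfl | hX
        · exact hn2
        · exact hnQ.mono hC'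
        · exact hn1
        · exact (hnl X hX).mono hC'
      · simp only [List.pairwise_cons, List.mem_cons, forall_eq_or_imp]
        have i1 := Set.image_mono (f := p) hs1
        have i2 := Set.image_mono (f := p) hs2
        exact ⟨⟨hPQ.mono i2 subset_rfl, h12.symm, fun X hX => (hPl X hX).mono i2 subset_rfl⟩,
          ⟨(hPQ.mono i1 subset_rfl).symm, hQl⟩, fun X hX => (hPl X hX).mono i1 subset_rfl, hll⟩
    rcases sl_pathcase hr1 hq hnQ hcard' with
      ⟨C', hC', hC'card, J1, J2, hs1, hs2, hp1, hp2, hn1, hn2, h12⟩ |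
      ⟨β', f', Bad', hβ', hf', hfib', hBad', hgood'⟩
    · refine ih p q J J2 ((q '' J1) :: l) C' (fun a ha b hb => hind a (hC' ha) b (hC' hb)) hp hp2
        ?_ ?_ (by simp; omega) (hC'card.trans hr)
      · intro X hX
        simp only [List.mem_cons] at hX
        rcases hX with rfl | rfl | rfl | hX
        · exact hnP.mono hC'
        · exact hn2
        · exact hn1
        · exact (hnl X hX).mono hC'
      · simp only [List.pairwise_cons, List.mem_cons, forall_eq_or_imp]
        have i1 := Set.image_mono (f := q) hs1
        have i2 := Set.image_mono (f := q) hs2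
        exact ⟨⟨hPQ.mono subset_rfl i2, hPQ.mono subset_rfl i1, hPl⟩,
          ⟨h12.symm, fun X hX => (hQl X hX).mono i2 subset_rfl⟩,
          fun X hX => (hQl X hX).mono i1 subset_rfl, hll⟩
    have hmem : ∀ c ∈ C \ (Bad ∪ Bad'), c ∈ C ∧ c ∉ Bad ∧ c ∉ Bad' := by
      intro c hc
      simp only [Finset.mem_sdiff, Finset.mem_union, not_or] at hc
      exact hc
    have hsz : k * k * (4 * r) < (C \ (Bad ∪ Bad')).card := by
      have h1 := Finset.le_card_sdiff (Bad ∪ Bad') C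
      have h2 := Finset.card_union_le Bad Bad'
      obtain ⟨r', rfl⟩ : ∃ r', r = r' + 1 := ⟨r - 1, by omega⟩
      simp only [Nat.add_sub_cancel] at hBad hBad'
      have h3 : k * k * (4 * (r' + 1)) = 4 * (k ^ 2 * r') + 4 * k ^ 2 := by ring
      have h4 : (2 * k ^ 2) * (4 * (r' + 1)) = 8 * (k ^ 2 * r') + 8 * k ^ 2 := by ring
      have h5 : 2 * k ^ 2 * r' = 2 * (k ^ 2 * r') := by ring
      omega
    obtain ⟨c, hc, hmono, hmono'⟩ := sl_grid (s := C \ (Bad ∪ Bad')) (k := k) (b := 4 * r)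
      (α := fun c => β (f c)) (β := fun c => β' (f' c))
      (fun t => hfib t _ (fun c hc => (hmem c (Finset.mem_filter.1 hc).1).1)
        (fun c hc => (Finset.mem_filter.1 hc).2))
      (fun t => hfib' t _ (fun c hc => (hmem c (Finset.mem_filter.1 hc).1).1)
        (fun c hc => (Finset.mem_filter.1 hc).2)) hsz
    have hcC : ∀ i, c i ∈ C := fun i => (hmem _ (hc i)).1
    refine sl_assemble hPQ c ?_ ?_ ?_ (fun i j => hind _ (hcC i) _ (hcC j))
      (sl_rail' hp hβ c (fun i => hf _ (hcC i))
        (fun i => hgood _ (hcC i) (hmem _ (hc i)).2.1) (Or.inl hmono))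
      (sl_rail' hq hβ' c (fun i => hf' _ (hcC i))
        (fun i => hgood' _ (hcC i) (hmem _ (hc i)).2.2) hmono')
    · intro i j hij
      apply hmono.injective
      simp only [hij]
    · exact fun i h => hnP.2.1 _ h (hcC i)
    · exact fun i h => hnQ.2.1 _ h (hcC i)

/-- In a creature-free graph, connected subsets of one side have few new boundary colours. -/
lemma sl_boundary {V : Type*} {G : SimpleGraph V} {k : ℕ} (hk : 1 ≤ k) (hfree : CreatureFree G k)
    {A B : Set V} {C : Finset V} (hind : ∀ a ∈ C, ∀ b ∈ C, ¬ G.Adj a b)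
    (hA : SLNice G C A) (hB : SLNice G C B) (hAB : SLAnti G A B) {A' : Set V} (hA' : A' ⊆ A)
    (hconn : (G.induce A').Connected) {N : Finset V} (hN : N ⊆ C)
    (hN' : ∀ c ∈ N, (∀ x ∈ A', ¬ G.Adj x c) ∧ ∃ x ∈ A, G.Adj x c ∧ ∃ y ∈ A', G.Adj x y) :
    N.card < k := by
  by_contra hcon
  have hle := not_lt.1 hcon
  let e : Fin k → V := fun i => (N.equivFin.symm (Fin.castLE hle i) : V)
  have he : Function.Injective e := by
    intro i j h
    have := N.equivFin.symm.injective (Subtype.ext h)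
    exact Fin.castLE_injective hle this
  have heN : ∀ i, e i ∈ N := fun i => (N.equivFin.symm (Fin.castLE hle i)).2
  have heC : ∀ i, e i ∈ C := fun i => hN (heN i)
  choose x hxA hxe y hyA hxy using fun i => (hN' (e i) (heN i)).2
  have hno : ∀ i, ∀ z ∈ A', ¬ G.Adj z (e i) := fun i => (hN' (e i) (heN i)).1
  have hxA' : ∀ i, x i ∉ A' := fun i h => hno i _ h (hxe i)
  obtain ⟨⟨a0, ha0⟩⟩ := hconn.nonempty
  obtain ⟨⟨b0, hb0⟩⟩ := hB.1.nonempty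
  let i0 : Fin k := ⟨0, hk⟩
  have hdAB : ∀ v, v ∈ A → v ∉ B := fun v hv hv' => Set.disjoint_left.1 hAB.1 hv hv'
  have hadj : ∀ i j, G.Adj (x i) (e j) ↔ i = j := by
    intro i j
    constructor
    · intro h
      exact he (hA.2.2.1 _ (hxA i) _ (heC i) _ (heC j) (hxe i) h)
    · rintro rfl; exact hxe i
  refine hfree A' B (Set.range x) (Set.range e) ⟨⟨a0, ha0⟩, ⟨b0, hb0⟩, ⟨x i0, i0, rfl⟩,
    ⟨e i0, i0, rfl⟩, ?_, ?_, ?_, ?_, ?_, ?_, hconn, hB.1, ?_, ?_, ?_, ?_, x, e, ?_, he, rfl, rfl,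
    hadj⟩
  · exact hAB.1.mono_left hA'
  · rw [Set.disjoint_left]
    rintro _ h ⟨i, rfl⟩
    exact hxA' i h
  · rw [Set.disjoint_left]
    rintro _ h ⟨i, rfl⟩
    exact hA.2.1 _ (hA' h) (heC i)
  · rw [Set.disjoint_left]
    rintro _ h ⟨i, rfl⟩
    exact hdAB _ (hxA i) h
  · rw [Set.disjoint_left]
    rintro _ h ⟨i, rfl⟩
    exact hB.2.1 _ h (heC i)
  · rw [Set.disjoint_left]
    rintro _ ⟨i, rfl⟩ ⟨j, h⟩
    exact hA.2.1 _ (hxA i) (h ▸ heC j)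
  · rintro a ha w (⟨i, rfl⟩ | hw) h
    · exact hno i a ha h
    · exact hAB.2 a (hA' ha) w hw h
  · rintro b hb w (hw | ⟨i, rfl⟩) h
    · exact hAB.2 w (hA' hw) b hb h.symm
    · exact hAB.2 _ (hxA i) b hb h.symm
  · rintro _ ⟨i, rfl⟩
    exact ⟨y i, hyA i, hxy i⟩
  · rintro _ ⟨i, rfl⟩
    obtain ⟨b, hb, h⟩ := hB.2.2.2 _ (heC i)
    exact ⟨b, hb, h.symm⟩
  · intro i j h
    exact (hadj i j).1 (h ▸ hxe j)

/-- A path seeing many colours. -/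
lemma sl_longpath {V : Type*} {G : SimpleGraph V} {k : ℕ} (hk : 1 ≤ k) {A : Set V} {C : Finset V}
    (hA : SLNice G C A)
    (hb : ∀ A' ⊆ A, (G.induce A').Connected → ∀ N ⊆ C,
      (∀ c ∈ N, (∀ x ∈ A', ¬ G.Adj x c) ∧ ∃ x ∈ A, G.Adj x c ∧ ∃ y ∈ A', G.Adj x y) → N.card < k)
    {t : ℕ} (ht1 : 1 ≤ t) (ht : k * t < C.card) :
    ∃ (p : ℕ → V) (J : Set ℕ) (C' : Finset V), SLPath G p J ∧ p '' J ⊆ A ∧ C' ⊆ C ∧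
      C'.card = t ∧ SLNice G C' (p '' J) := by
  classical
  obtain ⟨⟨a, ha⟩⟩ := hA.1.nonempty
  have key : ∀ t : ℕ, ∃ K ⊆ C, K.card ≤ (k - 1) * t + 1 ∧ (∀ c ∈ C, G.Adj a c → c ∈ K) ∧
      ∀ (z : V) (w : G.Walk a z), (∀ x ∈ w.support, x ∈ A) →
        (∃ x ∈ w.support, ∃ c ∈ C, c ∉ K ∧ G.Adj x c) →
        t ≤ (K.filter (fun c => ∃ x ∈ w.support, G.Adj x c)).card := by
    intro t
    induction t with
    | zero =>
      refine ⟨C.filter (fun c => G.Adj a c), Finset.filter_subset _ _, ?_, ?_, ?_⟩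
      · rw [mul_zero, zero_add, Finset.card_le_one]
        intro c hc d hd
        rw [Finset.mem_filter] at hc hd
        exact hA.2.2.1 a ha c hc.1 d hd.1 hc.2 hd.2
      · intro c hc h; exact Finset.mem_filter.2 ⟨hc, h⟩
      · intros; exact Nat.zero_le _
    | succ t ih =>
      obtain ⟨K, hKC, hKcard, haK, hK⟩ := ih
      let R : Set V := {x | ∃ w : G.Walk a x, ∀ y ∈ w.support, y ∈ A ∧ ∀ c ∈ C, G.Adj y c → c ∈ K}
      have haR : a ∈ R := ⟨Walk.nil, by
        intro y hy
        have : y = a := by simpa using hy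
        subst this
        exact ⟨ha, haK⟩⟩
      have hRmem : ∀ x ∈ R, x ∈ A ∧ ∀ c ∈ C, G.Adj x c → c ∈ K := by
        rintro x ⟨w, hw⟩
        exact hw x w.end_mem_support
      have hRconn : (G.induce R).Connected := by
        refine sl_conn_of_walks a haR ?_
        rintro v ⟨w, hw⟩
        refine ⟨w, fun x hx => ?_⟩
        exact ⟨w.takeUntil x hx, fun y hy => hw y (w.support_takeUntil_subset_support hx hy)⟩
      have hRext : ∀ x ∈ R, ∀ y ∈ A, G.Adj x y → (∀ c ∈ C, G.Adj y c → c ∈ K) → y ∈ R := by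
        rintro x ⟨w, hw⟩ y hy hxy hyc
        refine ⟨w.concat hxy, ?_⟩
        intro z hz
        rw [Walk.support_concat] at hz
        simp only [List.mem_append, List.mem_singleton] at hz
        rcases hz with hz | rfl
        · exact hw z hz
        · exact ⟨hy, hyc⟩
      let N : Finset V := C.filter (fun c => c ∉ K ∧ ∃ x ∈ A, G.Adj x c ∧ ∃ y ∈ R, G.Adj x y)
      have hNcard : N.card < k := by
        refine hb R (fun x hx => (hRmem x hx).1) hRconn N (Finset.filter_subset _ _) ?_
        intro c hc
        obtain ⟨hcC, hcK, hx⟩ := Finset.mem_filter.1 hc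
        exact ⟨fun x hx hadj => hcK ((hRmem x hx).2 c hcC hadj), hx⟩
      refine ⟨K ∪ N, Finset.union_subset hKC (Finset.filter_subset _ _), ?_, ?_, ?_⟩
      · have := Finset.card_union_le K N
        have h2 : (k - 1) * (t + 1) = (k - 1) * t + (k - 1) := by ring
        omega
      · intro c hc h; exact Finset.mem_union_left _ (haK c hc h)
      · intro z w hwA hex
        obtain ⟨x, hx, c, hcC, hcK, hxc⟩ := hex
        have hcK' : c ∉ K := fun h => hcK (Finset.mem_union_left _ h)
        have h1 := hK z w hwA ⟨x, hx, c, hcC, hcK', hxc⟩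
        have hxR : x ∉ R := fun h => hcK' ((hRmem x h).2 c hcC hxc)
        obtain ⟨d, hd, hdf, hds⟩ := (w.takeUntil x hx).exists_boundary_dart R haR hxR
        have hdw : d.snd ∈ w.support :=
          w.support_takeUntil_subset_support hx (Walk.dart_snd_mem_support_of_mem_darts _ hd)
        have hdA : d.snd ∈ A := hwA _ hdw
        have : ¬ ∀ c ∈ C, G.Adj d.snd c → c ∈ K := fun h => hds (hRext _ hdf _ hdA d.adj h)
        push Not at this
        obtain ⟨e, heC, hde, heK⟩ := this
        have heN : e ∈ N := Finset.mem_filter.2 ⟨heC, heK, d.snd, hdA, hde, d.fst, hdf, d.adj.symm⟩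
        have hsub : insert e (K.filter (fun c => ∃ x ∈ w.support, G.Adj x c)) ⊆
            (K ∪ N).filter (fun c => ∃ x ∈ w.support, G.Adj x c) := by
          intro c' hc'
          rw [Finset.mem_insert] at hc'
          rcases hc' with rfl | hc'
          · exact Finset.mem_filter.2 ⟨Finset.mem_union_right _ heN, _, hdw, hde⟩
          · rw [Finset.mem_filter] at hc' ⊢
            exact ⟨Finset.mem_union_left _ hc'.1, hc'.2⟩
        have h2 := Finset.card_le_card hsub
        rw [Finset.card_insert_of_notMem (fun h => heK (Finset.mem_filter.1 h).1)] at h2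
        omega
  obtain ⟨K, hKC, hKcard, -, hK⟩ := key t
  have hlt : K.card < C.card := by
    obtain ⟨k', rfl⟩ : ∃ k', k = k' + 1 := ⟨k - 1, by omega⟩
    simp only [Nat.add_sub_cancel] at hKcard
    have : (k' + 1) * t = k' * t + t := by ring
    omega
  obtain ⟨c, hcC, hcK⟩ := Finset.exists_mem_notMem_of_card_lt_card hlt
  obtain ⟨z, hzA, hzc⟩ := hA.2.2.2 c hcC
  obtain ⟨w, hw, hp⟩ := sl_shortest hA.1 ha hzA
  have h1 := hK z w hw ⟨z, w.end_mem_support, c, hcC, hcK, hzc⟩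
  obtain ⟨C', hC', hC'card⟩ := Finset.exists_subset_card_eq h1
  have hC'C : C' ⊆ C := fun x hx => hKC (Finset.mem_filter.1 (hC' hx)).1
  have hsub : w.getVert '' Set.Iic w.length ⊆ A := by
    rintro _ ⟨n, -, rfl⟩
    exact hw _ (w.getVert_mem_support n)
  refine ⟨w.getVert, Set.Iic w.length, C', hp, hsub, hC'C, hC'card, hp.connected ⟨0, by simp⟩,
    fun x hx hxC => hA.2.1 x (hsub hx) (hC'C hxC),
    fun x hx c hc d hd => hA.2.2.1 x (hsub hx) c (hC'C hc) d (hC'C hd), ?_⟩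
  intro c hc
  obtain ⟨x, hx, hadj⟩ := (Finset.mem_filter.1 (hC' hc)).2
  obtain ⟨n, rfl, hn⟩ := Walk.mem_support_iff_exists_getVert.1 hx
  exact ⟨_, ⟨n, hn, rfl⟩, hadj⟩

/-- The side of a separator. -/
def SLSide {V : Type*} (G : SimpleGraph V) (S : Set V) (u : V) : Set V :=
  {x | ∃ w : G.Walk u x, ∀ y ∈ w.support, y ∉ S}

lemma sl_side_ext {V : Type*} {G : SimpleGraph V} {S : Set V} {u x y : V} (hx : x ∈ SLSide G S u)
    (hy : y ∉ S) (hxy : G.Adj x y) : y ∈ SLSide G S u := by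
  obtain ⟨w, hw⟩ := hx
  refine ⟨w.concat hxy, ?_⟩
  intro z hz
  rw [Walk.support_concat] at hz
  simp only [List.mem_append, List.mem_singleton] at hz
  rcases hz with hz | rfl
  · exact hw z hz
  · exact hy

lemma sl_side_conn {V : Type*} {G : SimpleGraph V} {S : Set V} {u : V} (hu : u ∉ S) :
    (G.induce (SLSide G S u)).Connected := by
  classical
  refine sl_conn_of_walks u ⟨Walk.nil, by simpa using hu⟩ ?_
  rintro v ⟨w, hw⟩
  refine ⟨w, fun x hx => ?_⟩
  exact ⟨w.takeUntil x hx, fun y hy => hw y (w.support_takeUntil_subset_support hx hy)⟩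

lemma sl_side_see {V : Type*} {G : SimpleGraph V} {S : Set V} {u v s : V} (hu : u ∉ S)
    (hv : v ∉ SLSide G S u) (w : G.Walk u v) (hw : ∀ x ∈ w.support, x ∈ S → x = s) :
    ∃ x ∈ SLSide G S u, G.Adj x s := by
  obtain ⟨d, hd, hdf, hds⟩ := w.exists_boundary_dart (SLSide G S u)
    ⟨Walk.nil, by simpa using hu⟩ hv
  have hdS : d.snd ∈ S := by
    by_contra h
    exact hds (sl_side_ext hdf h d.adj)
  have := hw _ (Walk.dart_snd_mem_support_of_mem_darts _ hd) hdS
  exact ⟨d.fst, hdf, this ▸ d.adj⟩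

lemma sl_side_notMem {V : Type*} {G : SimpleGraph V} {S : Set V} {u x : V}
    (hx : x ∈ SLSide G S u) : x ∉ S := by
  obtain ⟨w, hw⟩ := hx
  exact hw x w.end_mem_support

/-- Lemma 6: a `k`-creature-free graph with a minimal separator `S` with
`ζ_G(S) > (8k²)^(k+2)` contains the `k`-skinny ladder as an induced minor. -/
theorem creatureFree_largeZeta_skinnyLadder_inducedMinor
    (k : ℕ) (hk : 1 ≤ k) {V : Type*} [Fintype V] (G : SimpleGraph V)
    (hfree : CreatureFree G k) (S : Set V) (hS : IsMinimalSeparator G S)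
    (hzeta : (8 * k ^ 2) ^ (k + 2) < zeta G S) :
    IsInducedMinor (skinnyLadder k) G := by
  classical
  obtain ⟨u, v, ⟨hu, hv, hsep⟩, hmin⟩ := hS
  obtain ⟨n, ⟨I, hIS, hIind, hI1, rfl⟩, hn⟩ := exists_lt_of_lt_csSup
    (by exact ⟨0, ∅, by simp, by simp, by simp, by simp⟩) hzeta
  have hfin : I.Finite := Set.toFinite I
  obtain ⟨C, rfl⟩ : ∃ C : Finset V, (C : Set V) = I := ⟨hfin.toFinset, by simp⟩
  rw [Set.ncard_coe_finset] at hn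
  have hind : ∀ a ∈ C, ∀ b ∈ C, ¬ G.Adj a b := fun a ha b hb => hIind a ha b hb
  have huniq : ∀ x, x ∉ S → ∀ c ∈ C, ∀ d ∈ C, G.Adj x c → G.Adj x d → c = d := by
    intro x hx c hc d hd h1 h2
    have := hI1 x hx
    rw [Set.ncard_le_one (Set.toFinite _)] at this
    exact this c ⟨hc, h1⟩ d ⟨hd, h2⟩
  have hvu : v ∉ SLSide G S u := by
    rintro ⟨w, hw⟩
    obtain ⟨x, hx, hxS⟩ := hsep w
    exact hw x hx hxS
  have huv : u ∉ SLSide G S v := by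
    rintro ⟨w, hw⟩
    obtain ⟨x, hx, hxS⟩ := hsep w.reverse
    exact hw x (by simpa using hx) hxS
  have hwalk : ∀ s ∈ S, ∃ w : G.Walk u v, ∀ x ∈ w.support, x ∈ S → x = s := by
    intro s hs
    have := hmin (S \ {s}) (Set.sdiff_singleton_ssubset.2 hs)
    by_contra hcon
    push Not at hcon
    refine this ⟨fun h => hu h.1, fun h => hv h.1, fun w => ?_⟩
    obtain ⟨x, hx, hxS, hne⟩ := hcon w
    exact ⟨x, hx, hxS, hne⟩
  have hA : SLNice G C (SLSide G S u) := by
    refine ⟨sl_side_conn hu, fun x hx hxC => sl_side_notMem hx (hIS hxC),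
      fun x hx => huniq x (sl_side_notMem hx), ?_⟩
    intro c hc
    obtain ⟨w, hw⟩ := hwalk c (hIS hc)
    exact sl_side_see hu hvu w hw
  have hB : SLNice G C (SLSide G S v) := by
    refine ⟨sl_side_conn hv, fun x hx hxC => sl_side_notMem hx (hIS hxC),
      fun x hx => huniq x (sl_side_notMem hx), ?_⟩
    intro c hc
    obtain ⟨w, hw⟩ := hwalk c (hIS hc)
    exact sl_side_see hv huv w.reverse (by simpa using hw)
  have hdisj : ∀ x, x ∈ SLSide G S u → x ∉ SLSide G S v := by
    rintro x ⟨w, hw⟩ ⟨w', hw'⟩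
    obtain ⟨y, hy, hyS⟩ := hsep (w.append w'.reverse)
    rw [Walk.mem_support_append_iff] at hy
    rcases hy with hy | hy
    · exact hw y hy hyS
    · exact hw' y (by simpa using hy) hyS
  have hAB : SLAnti G (SLSide G S u) (SLSide G S v) := by
    refine ⟨Set.disjoint_left.2 hdisj, ?_⟩
    intro a ha b hb hadj
    exact hdisj b (sl_side_ext ha (sl_side_notMem hb) hadj) hb
  -- sizes
  obtain ⟨r, hr⟩ : ∃ r, r = 2 * (8 * k ^ 2) ^ k := ⟨_, rfl⟩
  have hk2 : 1 ≤ k ^ 2 := Nat.one_le_pow _ _ hk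
  have hr1 : 1 ≤ r := by
    have : 0 < (8 * k ^ 2) ^ k := by positivity
    omega
  have hsz : k * (k * r + 1) < C.card := by
    refine lt_of_le_of_lt ?_ hn
    have h1 : (8 * k ^ 2) ^ (k + 2) = 32 * (k ^ 2 * k ^ 2 * r) := by rw [hr]; ring
    have h2 : k * (k * r + 1) = k ^ 2 * r + k := by ring
    have h3 : k ^ 2 * r ≤ k ^ 2 * k ^ 2 * r :=
      Nat.mul_le_mul_right _ (Nat.le_mul_of_pos_left _ hk2)
    have h4 : k ≤ k ^ 2 * r := by nlinarith
    omega
  obtain ⟨p, J, C1, hp, hpA, hC1, hC1card, hn1⟩ := sl_longpath hk hA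
    (fun A' hA' hc N hN hN' => sl_boundary hk hfree hind hA hB hAB hA' hc hN hN')
    (t := k * r + 1) (by omega) hsz
  have hind1 : ∀ a ∈ C1, ∀ b ∈ C1, ¬ G.Adj a b := fun a ha b hb => hind a (hC1 ha) b (hC1 hb)
  obtain ⟨q, L, C2, hq, hqB, hC2, hC2card, hn2⟩ := sl_longpath hk (hB.mono hC1)
    (fun A' hA' hc N hN hN' => sl_boundary hk hfree hind1 (hB.mono hC1) (hA.mono hC1) hAB.symm
      hA' hc hN hN')
    (t := r) hr1 (by omega)
  refine sl_main hk hfree k p q J L [] C2 (fun a ha b hb => hind1 a (hC2 ha) b (hC2 hb)) hp hq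
    ?_ ?_ (by simp) (hC2card.trans hr)
  · intro X hX
    simp only [List.mem_cons, List.not_mem_nil, or_false] at hX
    rcases hX with rfl | rfl
    · exact hn1.mono hC2
    · exact hn2
  · simpa using hAB.mono hpA hqB
end

section
/- Under the Setup, let Z_A ⊆ N(v) \ S \ B be an inclusion-minimal set such that S_A ⊆ N(Z_A), and suppose Z_A is nonempty. Then G contains a |Z_A|-creature; one may take the creature to be ({v}, T \ {u}, Z_A, S_{A,Z}), where S_{A,Z} ⊆ S_A is a set of private neighbors, one for each vertex of Z_A. -/
open SimpleGraph

/-- Claim 1: under the Setup, an inclusion-minimal nonempty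
`Z_A ⊆ N(v) \ S \ B` dominating `S_A` yields a `|Z_A|`-creature
`({v}, T \ {u}, Z_A, S_{A,Z})` with `S_{A,Z} ⊆ S_A`. -/
theorem setup_ZA_creature
    {V : Type*} [Fintype V] (G : SimpleGraph V) (S A B : Set V)
    (hS : IsMinimalSeparator G S)
    (hA : IsCompOf G Sᶜ A) (hB : IsCompOf G Sᶜ B) (hAB : A ≠ B)
    (hNA : nbhd G A = S) (hNB : nbhd G B = S)
    (hnodom : ¬ ∃ w, w ∉ S ∧ S ⊆ G.neighborSet w)
    (T : Set V) (hTB : T ⊆ B) (hTconn : (G.induce T).Connected)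
    (hTdom : S ⊆ nbhd G T)
    (hTmin : ∀ T' ⊂ T, ¬ ((G.induce T').Connected ∧ S ⊆ nbhd G T'))
    (u : V) (hu : u ∈ T) (huconn : (G.induce (T \ {u})).Connected)
    (v : V) (hv : v ∈ S ∩ G.neighborSet u) (hvpriv : v ∉ nbhd G (T \ {u}))
    (Su Sv SA : Set V)
    (hSu : Su = G.neighborSet u ∩ S)
    (hSv : Sv = (G.neighborSet v ∩ S) \ Su)
    (hSA : SA = ((S \ Su) \ Sv) ∩ nbhd G ((G.neighborSet v \ S) \ B))
    (ZA : Set V) (hZA : ZA ⊆ (G.neighborSet v \ S) \ B)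
    (hZAdom : SA ⊆ nbhd G ZA)
    (hZAmin : ∀ Z' ⊂ ZA, ¬ SA ⊆ nbhd G Z')
    (hZAne : ZA.Nonempty) :
    ∃ SAZ ⊆ SA, IsCreature G ZA.ncard {v} (T \ {u}) ZA SAZ := by
  have hpriv : ∀ z : ZA, ∃ s ∈ SA, ∀ z' ∈ ZA, G.Adj z' s ↔ z' = z := by
    rintro ⟨z, hz⟩
    have h1 := hZAmin (ZA \ {z}) ⟨Set.sdiff_subset, fun h => (h hz).2 rfl⟩
    obtain ⟨s, hs, hs'⟩ := Set.not_subset.1 h1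
    have hsZ := hZAdom hs
    obtain ⟨hsn, a, ha, hadj⟩ := hsZ
    have key : ∀ z' ∈ ZA, G.Adj z' s → z' = z := by
      intro z' hz' hadj'
      by_contra hne
      exact hs' ⟨fun h => hsn h.1, z', ⟨hz', hne⟩, hadj'.symm⟩
    refine ⟨s, hs, fun z' hz' => ⟨key z' hz', ?_⟩⟩
    rintro rfl
    have := key a ha hadj.symm
    subst this
    exact hadj.symm
  choose f hfSA hf using hpriv
  have hSAmem : ∀ s ∈ SA, s ∈ S ∧ ¬ G.Adj u s ∧ ¬ G.Adj v s := by
    intro s hs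
    rw [hSA] at hs
    obtain ⟨⟨⟨h1, h2⟩, h3⟩, -⟩ := hs
    have h4 : ¬ G.Adj u s := fun h => h2 (hSu ▸ ⟨h, h1⟩)
    refine ⟨h1, h4, fun h => h3 ?_⟩
    rw [hSv]
    exact ⟨⟨h, h1⟩, h2⟩
  have hBS : ∀ b ∈ B, b ∉ S := fun b hb => hB.1 hb
  have hvS : v ∈ S := hv.1
  have hvT : ∀ b ∈ T \ {u}, ¬ G.Adj v b := by
    intro b hb hadj
    exact hvpriv ⟨fun h => hBS v (hTB h.1) hvS, b, hb, hadj⟩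
  have hfinj : Function.Injective f := by
    intro z z' h
    have h1 := (hf z z z.2).2 rfl
    rw [h] at h1
    exact Subtype.ext ((hf z' z z.2).1 h1)
  have e : Fin ZA.ncard ≃ ZA := (Finite.equivFinOfCardEq (Nat.card_coe_set_eq ZA)).symm
  refine ⟨Set.range f, ?_, ⟨v, rfl⟩, ?_, hZAne, ?_, ?_, ?_, ?_, ?_, ?_, ?_, ?_, huconn, ?_, ?_, ?_, ?_,
    fun i => e i, fun i => f (e i), ?_, ?_, ?_, ?_, ?_⟩
  · rintro _ ⟨z, rfl⟩; exact hfSA z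
  · exact Set.nonempty_coe_sort.1 huconn.nonempty
  · exact ⟨f ⟨_, hZAne.some_mem⟩, _, rfl⟩
  · rw [Set.disjoint_singleton_left]
    exact fun h => hBS v (hTB h.1) hvS
  · rw [Set.disjoint_singleton_left]
    exact fun h => (hZA h).1.2 hvS
  · rw [Set.disjoint_singleton_left]
    rintro ⟨z, hz⟩
    exact (hSAmem _ (hfSA z)).2.1 (hz ▸ hv.2)
  · rw [Set.disjoint_left]
    exact fun a ha h => (hZA h).2 (hTB ha.1)
  · rw [Set.disjoint_left]
    rintro _ ha ⟨z, rfl⟩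
    exact hBS _ (hTB ha.1) (hSAmem _ (hfSA z)).1
  · rw [Set.disjoint_left]
    rintro _ ha ⟨z, rfl⟩
    exact (hZA ha).1.2 (hSAmem _ (hfSA z)).1
  · exact SimpleGraph.Connected.of_subsingleton
  · rintro a rfl w (⟨z, rfl⟩ | hw)
    · exact (hSAmem _ (hfSA z)).2.2
    · exact hvT w hw
  · rintro b hb w (rfl | hw) hadj
    · exact hvT b hb hadj.symm
    · exact (hZA hw).2 (hB.2.2.2 b (hTB hb.1) w (hZA hw).1.2 hadj)
  · exact fun x hx => ⟨v, rfl, (hZA hx).1.1.symm⟩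
  · rintro _ ⟨z, rfl⟩
    obtain ⟨-, t, ht, hadj⟩ := hTdom (hSAmem _ (hfSA z)).1
    refine ⟨t, ⟨ht, ?_⟩, hadj⟩
    rintro rfl
    exact (hSAmem _ (hfSA z)).2.1 hadj.symm
  · exact Subtype.val_injective.comp e.injective
  · exact hfinj.comp e.injective
  · exact (e.surjective.range_comp Subtype.val).trans Subtype.range_coe
  · exact e.surjective.range_comp f
  · intro i j
    rw [hf (e j) (e i) (e i).2, Subtype.coe_inj, e.injective.eq_iff]
end

section
/- Under the Setup, let D be a connected component of G[A \ N(v)], and let Z_D ⊆ N(v) ∩ B be an inclusion-minimal set such that N(D) ∩ S_B ⊆ N(Z_D); suppose Z_D is nonempty. Then G contains a |Z_D|-creature; one may take the creature to be ({v}, D, Z_D, S_{B,Z}), where S_{B,Z} ⊆ N(D) ∩ S_B is a set of private neighbors, one for each vertex of Z_D. -/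
open SimpleGraph

theorem comp_subset_aux {V : Type*} (G : SimpleGraph V) (U A B : Set V)
    (hA : IsCompOf G U A) (hB : IsCompOf G U B) (x : V) (hxA : x ∈ A) (hxB : x ∈ B) : A ⊆ B := by
  intro y hy
  have key : ∀ (a b : A), (G.induce A).Walk a b → (a : V) ∈ B → (b : V) ∈ B := by
    intro a b p
    induction p with
    | nil => exact id
    | cons h p ih => exact fun ha => ih (hB.2.2.2 _ ha _ (hA.1 (Subtype.property _)) h)
  obtain ⟨p⟩ := hA.2.2.1.preconnected ⟨x, hxA⟩ ⟨y, hy⟩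
  exact key _ _ p hxB

/-- Claim 3: under the Setup, for a connected component `D` of
`G[A \ N(v)]` and an inclusion-minimal nonempty `Z_D ⊆ N(v) ∩ B` dominating `N(D) ∩ S_B`,
there is a `|Z_D|`-creature `({v}, D, Z_D, S_{B,Z})` with `S_{B,Z} ⊆ N(D) ∩ S_B`. -/
theorem setup_ZD_creature
    {V : Type*} [Fintype V] (G : SimpleGraph V) (S A B : Set V)
    (hS : IsMinimalSeparator G S)
    (hA : IsCompOf G Sᶜ A) (hB : IsCompOf G Sᶜ B) (hAB : A ≠ B)
    (hNA : nbhd G A = S) (hNB : nbhd G B = S)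
    (hnodom : ¬ ∃ w, w ∉ S ∧ S ⊆ G.neighborSet w)
    (T : Set V) (hTB : T ⊆ B) (hTconn : (G.induce T).Connected)
    (hTdom : S ⊆ nbhd G T)
    (hTmin : ∀ T' ⊂ T, ¬ ((G.induce T').Connected ∧ S ⊆ nbhd G T'))
    (u : V) (hu : u ∈ T) (huconn : (G.induce (T \ {u})).Connected)
    (v : V) (hv : v ∈ S ∩ G.neighborSet u) (hvpriv : v ∉ nbhd G (T \ {u}))
    (Su Sv SA SB : Set V)
    (hSu : Su = G.neighborSet u ∩ S)
    (hSv : Sv = (G.neighborSet v ∩ S) \ Su)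
    (hSA : SA = ((S \ Su) \ Sv) ∩ nbhd G ((G.neighborSet v \ S) \ B))
    (hSB : SB = (((S \ Su) \ Sv) \ SA) ∩ nbhd G (G.neighborSet v ∩ B))
    (D : Set V) (hD : IsCompOf G (A \ G.neighborSet v) D)
    (ZD : Set V) (hZD : ZD ⊆ G.neighborSet v ∩ B)
    (hZDdom : nbhd G D ∩ SB ⊆ nbhd G ZD)
    (hZDmin : ∀ Z' ⊂ ZD, ¬ nbhd G D ∩ SB ⊆ nbhd G Z')
    (hZDne : ZD.Nonempty) :
    ∃ SBZ ⊆ nbhd G D ∩ SB, IsCreature G ZD.ncard {v} D ZD SBZ := by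
  have hdisj : ∀ x, x ∈ A → x ∉ B := fun x h1 h2 => hAB
    (Set.Subset.antisymm (comp_subset_aux G _ A B hA hB x h1 h2)
      (comp_subset_aux G _ B A hB hA x h2 h1))
  have hedge : ∀ a ∈ A, ∀ b ∈ B, ¬ G.Adj a b := fun a ha b hb h =>
    hdisj b (hA.2.2.2 a ha b (hB.1 hb) h) hb
  have hDA : ∀ d ∈ D, d ∈ A ∧ ¬ G.Adj v d := fun d hd => hD.1 hd
  have hAS : ∀ a ∈ A, a ∉ S := fun a ha => hA.1 ha
  have hBS : ∀ a ∈ B, a ∉ S := fun a ha => hB.1 ha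
  have hZB : ∀ z ∈ ZD, G.Adj v z ∧ z ∈ B := fun z hz => hZD hz
  have hvS : v ∈ S := hv.1
  have huv : G.Adj u v := hv.2
  have hSBS : ∀ y ∈ SB, y ∈ S ∧ y ≠ v ∧ ¬ G.Adj v y := by
    intro y hy
    rw [hSB] at hy
    obtain ⟨⟨⟨⟨h1, h2⟩, h3⟩, -⟩, -⟩ := hy
    refine ⟨h1, ?_, ?_⟩
    · rintro rfl
      exact h2 (hSu ▸ ⟨huv, h1⟩)
    · intro h
      exact h3 (hSv ▸ ⟨⟨h, h1⟩, h2⟩)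
  have hpriv : ∀ z : ZD, ∃ y, y ∈ nbhd G D ∩ SB ∧ ∀ z' ∈ ZD, G.Adj z' y ↔ z' = z := by
    rintro ⟨z, hz⟩
    have h := hZDmin (ZD \ {z}) ⟨Set.sdiff_subset, fun h => (h hz).2 rfl⟩
    obtain ⟨y, hy, hny⟩ := Set.not_subset.1 h
    have hne : ∀ z' ∈ ZD, z' ≠ z → ¬ G.Adj z' y := by
      intro z' hz' hzz hadj
      refine hny ⟨fun hh => hBS y (hZB y hh.1).2 (hSBS y hy.2).1, z', ⟨hz', hzz⟩, hadj.symm⟩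
    obtain ⟨-, w, hw, hyw⟩ := hZDdom hy
    have hwz : w = z := by
      by_contra hc
      exact hne w hw hc hyw.symm
    subst hwz
    refine ⟨y, hy, fun z' hz' => ⟨fun h => ?_, ?_⟩⟩
    · by_contra hc
      exact hne z' hz' hc h
    · rintro rfl
      exact hyw.symm
  choose f hf hfadj using hpriv
  have hfinj : Function.Injective f := by
    intro a b hab
    have h1 := (hfadj a a a.2).2 rfl
    rw [hab] at h1
    exact Subtype.ext ((hfadj b a a.2).1 h1)
  have hsub : Set.range f ⊆ nbhd G D ∩ SB := by
    rintro _ ⟨z, rfl⟩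
    exact hf z
  have e : Fin ZD.ncard ≃ ZD := by
    rw [← Nat.card_coe_set_eq]
    exact (Finite.equivFin ZD).symm
  refine ⟨Set.range f, hsub, Set.singleton_nonempty v, hD.2.1, hZDne,
    ⟨f ⟨_, hZDne.some_mem⟩, Set.mem_range_self _⟩, ?_, ?_, ?_, ?_, ?_, ?_, ?_, hD.2.2.1,
    ?_, ?_, ?_, ?_, fun i => (e i : V), fun i => f (e i),
    Subtype.val_injective.comp e.injective, hfinj.comp e.injective, ?_, ?_, ?_⟩
  · exact Set.disjoint_singleton_left.2 fun h => hAS v (hDA v h).1 hvS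
  · exact Set.disjoint_singleton_left.2 fun h => hBS v (hZB v h).2 hvS
  · exact Set.disjoint_singleton_left.2 fun h => (hSBS v (hsub h).2).2.1 rfl
  · exact Set.disjoint_left.2 fun x h1 h2 => hdisj x (hDA x h1).1 (hZB x h2).2
  · exact Set.disjoint_left.2 fun x h1 h2 => hAS x (hDA x h1).1 (hSBS x (hsub h2).2).1
  · exact Set.disjoint_left.2 fun x h1 h2 => hBS x (hZB x h1).2 (hSBS x (hsub h2).2).1
  · have : Subsingleton ({v} : Set V) :=
      ⟨fun a b => Subtype.ext (a.2.trans b.2.symm)⟩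
    have : Nonempty ({v} : Set V) := ⟨⟨v, rfl⟩⟩
    exact ⟨Preconnected.of_subsingleton⟩
  · rintro a rfl w (hw | hw)
    · exact (hSBS w (hsub hw).2).2.2
    · exact (hDA w hw).2
  · rintro b hb w (hw | hw) h
    · rw [Set.mem_singleton_iff] at hw
      exact (hDA b hb).2 (hw ▸ h.symm)
    · exact hedge b (hDA b hb).1 w (hZB w hw).2 h
  · exact fun x hx => ⟨v, rfl, (hZB x hx).1.symm⟩
  · exact fun y hy => (hsub hy).1.2
  · ext x
    constructor
    · rintro ⟨i, rfl⟩
      exact (e i).2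
    · exact fun hx => ⟨e.symm ⟨x, hx⟩, by simp⟩
  · exact e.surjective.range_comp f
  · intro i j
    rw [hfadj (e j) (e i) (e i).2, Subtype.coe_inj, e.apply_eq_iff_eq]
end

section
/- If a finite simple graph G contains a k-creature (as an induced subgraph), then G has at least 2^k minimal separators. -/
open SimpleGraph

lemma walk_in_of_connected {V : Type*} (G : SimpleGraph V) (A : Set V)
    (hA : (G.induce A).Connected) {a w : V} (ha : a ∈ A) (hw : w ∈ A) :
    ∃ p : G.Walk a w, ∀ z ∈ p.support, z ∈ A := by
  obtain ⟨p⟩ := hA.preconnected ⟨a, ha⟩ ⟨w, hw⟩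
  refine ⟨p.map (Embedding.induce A).toHom, ?_⟩
  intro z hz
  have hz' := (Walk.support_map (Embedding.induce A).toHom p) ▸ hz
  obtain ⟨q, _, rfl⟩ := List.mem_map.1 hz'
  exact q.2

lemma walk_stays {V : Type*} (G : SimpleGraph V) (P Q : Set V)
    (hPQ : ∀ a ∈ P, ∀ b ∈ Q, ¬ G.Adj a b) {u v : V} (p : G.Walk u v) (hu : u ∈ P)
    (hp : ∀ z ∈ p.support, z ∈ P ∪ Q) : v ∈ P := by
  induction p with
  | nil => exact hu
  | cons h p ih =>
    apply ih
    · rcases hp _ (List.mem_cons_of_mem _ p.start_mem_support) with h1 | h1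
      · exact h1
      · exact absurd h (hPQ _ hu _ h1)
    · intro z hz
      exact hp z (by simp [Walk.support_cons, hz])

lemma creature_exists_sep {V : Type*} [Fintype V] (G : SimpleGraph V) (k : ℕ)
    (A B : Set V) (x y : Fin k → V) {a b : V} (ha : a ∈ A) (hb : b ∈ B)
    (hAB : Disjoint A B) (hAy : ∀ i, y i ∉ A) (hBx : ∀ i, x i ∉ B)
    (hxy : ∀ i j, x i ≠ y j) (hx : Function.Injective x)
    (hA : (G.induce A).Connected) (hB : (G.induce B).Connected)
    (hnAB : ∀ a ∈ A, ∀ b ∈ B, ¬ G.Adj a b)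
    (hnAy : ∀ a ∈ A, ∀ i, ¬ G.Adj a (y i))
    (hnBx : ∀ b ∈ B, ∀ i, ¬ G.Adj b (x i))
    (hxA : ∀ i, ∃ a ∈ A, G.Adj (x i) a) (hyB : ∀ i, ∃ b ∈ B, G.Adj (y i) b)
    (hadj : ∀ i j, G.Adj (x i) (y j) ↔ i = j) (I : Set (Fin k)) :
    ∃ S : Set V, IsMinimalSeparator G S ∧ ∀ i, x i ∈ S ↔ i ∉ I := by
  set P : Set V := A ∪ x '' I with hP
  set Q : Set V := B ∪ y '' Iᶜ with hQ
  have hPQ : ∀ a ∈ P, ∀ b ∈ Q, ¬ G.Adj a b := by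
    rintro p (hp | ⟨i, hi, rfl⟩) q (hq | ⟨j, hj, rfl⟩) h
    · exact hnAB _ hp _ hq h
    · exact hnAy _ hp _ h
    · exact hnBx _ hq _ h.symm
    · exact hj ((hadj i j).1 h ▸ hi)
  have hbP : b ∉ P := by
    rintro (h | ⟨i, _, rfl⟩)
    · exact Set.disjoint_left.1 hAB h hb
    · exact hBx _ hb
  have hsep : IsUVSeparator G (P ∪ Q)ᶜ a b := by
    refine ⟨fun h => h (Or.inl (Or.inl ha)), fun h => h (Or.inr (Or.inl hb)), fun p => ?_⟩
    by_contra! hc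
    exact hbP (walk_stays G P Q hPQ p (Or.inl ha) fun z hz => not_not.1 (hc z hz))
  obtain ⟨S, hSC, hS⟩ := exists_minimal_le_of_wellFoundedLT
    (fun S : Set V => IsUVSeparator G S a b) _ hsep
  have hd : ∀ z ∈ P ∪ Q, z ∉ S := fun z hz hzS => hSC hzS hz
  refine ⟨S, ⟨a, b, hS.prop, fun S' hS' h => hS'.2 (hS.le_of_le h hS'.1)⟩, fun i => ⟨?_, ?_⟩⟩
  · intro h hi
    exact hd _ (Or.inl (Or.inr ⟨i, hi, rfl⟩)) h
  · intro hi
    by_contra hxS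
    obtain ⟨a', ha', haa⟩ := hxA i
    obtain ⟨b', hb', hbb⟩ := hyB i
    obtain ⟨p, hp⟩ := walk_in_of_connected G A hA ha ha'
    obtain ⟨q, hq⟩ := walk_in_of_connected G B hB hb' hb
    obtain ⟨w, hw, hwS⟩ := hS.prop.2.2
      (p.append (Walk.cons haa.symm (Walk.cons ((hadj i i).2 rfl) (Walk.cons hbb q))))
    simp only [Walk.mem_support_append_iff, Walk.support_cons, List.mem_cons] at hw
    rcases hw with hw | rfl | rfl | rfl | hw
    · exact hd _ (Or.inl (Or.inl (hp _ hw))) hwS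
    · exact hd _ (Or.inl (Or.inl ha')) hwS
    · exact hxS hwS
    · exact hd _ (Or.inr (Or.inr ⟨i, hi, rfl⟩)) hwS
    · exact hd _ (Or.inr (Or.inl (hq _ hw))) hwS

/-- a graph containing a `k`-creature has at least `2^k` minimal separators. -/
theorem creature_minimalSeparators_ge
    {V : Type*} [Fintype V] (G : SimpleGraph V) (k : ℕ)
    (h : ∃ A B X Y : Set V, IsCreature G k A B X Y) :
    2 ^ k ≤ {S : Set V | IsMinimalSeparator G S}.ncard := by
  obtain ⟨A, B, X, Y, ⟨a, ha⟩, ⟨b, hb⟩, -, -, hAB, hAX, hAY, hBX, hBY, hXY, hA, hB, hnA, hnB,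
    hXA, hYB, x, y, hx, hy, rfl, rfl, hadj⟩ := h
  have key := creature_exists_sep G k A B x y ha hb hAB
    (fun i h => Set.disjoint_left.1 hAY h ⟨i, rfl⟩)
    (fun i h => Set.disjoint_left.1 hBX h ⟨i, rfl⟩)
    (fun i j h => Set.disjoint_left.1 hXY ⟨i, rfl⟩ ⟨j, h.symm⟩) hx hA hB
    (fun a ha b hb => hnA a ha b (Or.inr hb))
    (fun a ha i => hnA a ha _ (Or.inl ⟨i, rfl⟩))
    (fun b hb i => hnB b hb _ (Or.inr ⟨i, rfl⟩))
    (fun i => hXA _ ⟨i, rfl⟩) (fun i => hYB _ ⟨i, rfl⟩) hadj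
  choose f hf1 hf2 using key
  have hinj : Function.Injective
      (fun I => (⟨f I, hf1 I⟩ : {S : Set V | IsMinimalSeparator G S})) := by
    intro I J h
    have h' : f I = f J := congrArg Subtype.val h
    ext i
    have h1 := hf2 I i
    have h2 := hf2 J i
    rw [h'] at h1
    tauto
  have hc := Nat.card_le_card_of_injective _ hinj
  rw [Nat.card_coe_set_eq] at hc
  simpa using hc
end

section
/- For every k ≥ 3, the (k,1)-prism has exactly 2^k − 2 minimal separators; namely, the minimal separators are precisely the sets containing exactly one endpoint of each matching edge x_i y_i, with the exception of the two sets {x_1,…,x_k} and {y_1,…,y_k}. -/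
open SimpleGraph

/-- The `(k,1)`-prism: `(0, i) = xᵢ`, `(1, i) = yᵢ`; the `x`s and `y`s form cliques,
plus the matching edges `xᵢyᵢ`. -/
def prism (k : ℕ) : SimpleGraph (Fin 2 × Fin k) :=
  SimpleGraph.fromRel (fun a b => (a.1 = b.1 ∧ a.2 ≠ b.2) ∨ (a.1 ≠ b.1 ∧ a.2 = b.2))

theorem prism_adj_iff {k : ℕ} (x y : Fin 2 × Fin k) :
    (prism k).Adj x y ↔ (x.1 = y.1 ∧ x.2 ≠ y.2) ∨ (x.1 ≠ y.1 ∧ x.2 = y.2) := by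
  obtain ⟨a, i⟩ := x
  obtain ⟨b, j⟩ := y
  simp only [prism, SimpleGraph.fromRel_adj, ne_eq, Prod.mk.injEq]
  grind

/-- Two vertices agreeing in a coordinate are joined by a walk on these two vertices only. -/
theorem prism_short_walk {k : ℕ} (x y : Fin 2 × Fin k) (h : x.1 = y.1 ∨ x.2 = y.2) :
    ∃ p : (prism k).Walk x y, ∀ w ∈ p.support, w = x ∨ w = y := by
  by_cases hxy : x = y
  · subst hxy
    exact ⟨SimpleGraph.Walk.nil, by simp⟩
  · have hadj : (prism k).Adj x y := by
      rw [prism_adj_iff]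
      by_contra hc
      apply hxy
      ext1 <;> grind
    exact ⟨hadj.toWalk, by simp⟩

theorem prism_sep_props {k : ℕ} {S : Set (Fin 2 × Fin k)} {u v : Fin 2 × Fin k}
    (h : IsUVSeparator (prism k) S u v) :
    u.1 ≠ v.1 ∧ ∀ l, ∃ c, (c, l) ∈ S := by
  obtain ⟨hu, hv, hp⟩ := h
  constructor
  · intro he
    obtain ⟨p, hps⟩ := prism_short_walk u v (Or.inl he)
    obtain ⟨w, hw, hwS⟩ := hp p
    rcases hps w hw with rfl | rfl <;> contradiction
  · intro l
    by_contra hc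
    push Not at hc
    obtain ⟨p, hps⟩ := prism_short_walk u (u.1, l) (Or.inl rfl)
    obtain ⟨q, hqs⟩ := prism_short_walk (u.1, l) (v.1, l) (Or.inr rfl)
    obtain ⟨r, hrs⟩ := prism_short_walk (v.1, l) v (Or.inl rfl)
    obtain ⟨w, hw, hwS⟩ := hp ((p.append q).append r)
    have h1 := hc u.1
    have h2 := hc v.1
    simp only [SimpleGraph.Walk.mem_support_append_iff] at hw
    rcases hw with (hw | hw) | hw
    · rcases hps w hw with rfl | rfl <;> contradiction
    · rcases hqs w hw with rfl | rfl <;> contradiction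
    · rcases hrs w hw with rfl | rfl <;> contradiction

theorem prism_walk_layer {k : ℕ} (f : Fin k → Fin 2) {x y : Fin 2 × Fin k}
    (p : (prism k).Walk x y)
    (hp : ∀ w ∈ p.support, w ∉ Set.range (fun i => (f i, i))) : x.1 = y.1 := by
  induction p with
  | nil => rfl
  | @cons a b c hadj q ih =>
    have ha : f a.2 ≠ a.1 := fun he => hp a (by simp) ⟨a.2, by ext1 <;> simp [he]⟩
    have hb : f b.2 ≠ b.1 := fun he => hp b (by simp) ⟨b.2, by ext1 <;> simp [he]⟩
    have hbc := ih (fun w hw => hp w (by simp [hw]))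
    rw [← hbc]
    rw [prism_adj_iff] at hadj
    rcases hadj with h | h
    · exact h.1
    · rw [← h.2] at hb
      omega

theorem prism_transversal_sep {k : ℕ} (f : Fin k → Fin 2) {u v : Fin 2 × Fin k}
    (huv : u.1 ≠ v.1) (hu : u ∉ Set.range (fun i => (f i, i)))
    (hv : v ∉ Set.range (fun i => (f i, i))) :
    IsUVSeparator (prism k) (Set.range (fun i => (f i, i))) u v := by
  refine ⟨hu, hv, fun p => ?_⟩
  by_contra hc
  push Not at hc
  exact huv (prism_walk_layer f p hc)

theorem prism_minSep_eq (k : ℕ) :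
    {S : Set (Fin 2 × Fin k) | IsMinimalSeparator (prism k) S} =
      {S | ∃ f : Fin k → Fin 2, S = Set.range (fun i => (f i, i)) ∧
        f ≠ (fun _ => 0) ∧ f ≠ (fun _ => 1)} := by
  ext S
  simp only [Set.mem_setOf_eq]
  constructor
  · rintro ⟨u, v, hsep, hmin⟩
    obtain ⟨huv, hall⟩ := prism_sep_props hsep
    choose f hf using hall
    have hsub : Set.range (fun i => (f i, i)) ⊆ S := by
      rintro _ ⟨i, rfl⟩
      exact hf i
    have hT := prism_transversal_sep f huv (fun h => hsep.1 (hsub h)) (fun h => hsep.2.1 (hsub h))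
    have heq : S = Set.range (fun i => (f i, i)) := by
      by_contra hne
      exact hmin _ (hsub.ssubset_of_ne (Ne.symm hne)) hT
    have ha : f u.2 ≠ u.1 := fun he => hT.1 ⟨u.2, by ext1 <;> simp [he]⟩
    have hb : f v.2 ≠ v.1 := fun he => hT.2.1 ⟨v.2, by ext1 <;> simp [he]⟩
    refine ⟨f, heq, ?_, ?_⟩
    · intro h
      have h1 := congrFun h u.2
      have h2 := congrFun h v.2
      omega
    · intro h
      have h1 := congrFun h u.2
      have h2 := congrFun h v.2
      omega
  · rintro ⟨f, rfl, h0, h1⟩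
    obtain ⟨i, hi⟩ := Function.ne_iff.1 h0
    obtain ⟨j, hj⟩ := Function.ne_iff.1 h1
    refine ⟨(0, i), (1, j), prism_transversal_sep f (by simp) ?_ ?_, ?_⟩
    · rintro ⟨l, hl⟩
      simp only [Prod.mk.injEq] at hl
      exact hi (hl.2 ▸ hl.1)
    · rintro ⟨l, hl⟩
      simp only [Prod.mk.injEq] at hl
      exact hj (hl.2 ▸ hl.1)
    · intro S' hS' hsep
      apply hS'.2
      rintro _ ⟨l, rfl⟩
      obtain ⟨c, hc⟩ := (prism_sep_props hsep).2 l
      obtain ⟨m, hm⟩ := hS'.1 hc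
      simp only [Prod.mk.injEq] at hm
      obtain ⟨hm1, rfl⟩ := hm
      rw [← hm1] at hc
      exact hc

theorem prism_transversal_count (k : ℕ) (hk : 3 ≤ k) :
    {S : Set (Fin 2 × Fin k) | ∃ f : Fin k → Fin 2, S = Set.range (fun i => (f i, i)) ∧
        f ≠ (fun _ => 0) ∧ f ≠ (fun _ => 1)}.ncard = 2 ^ k - 2 := by
  have himg : {S : Set (Fin 2 × Fin k) | ∃ f : Fin k → Fin 2,
      S = Set.range (fun i => (f i, i)) ∧ f ≠ (fun _ => 0) ∧ f ≠ (fun _ => 1)} =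
      (fun f : Fin k → Fin 2 => Set.range (fun i => (f i, i))) ''
        ({(fun _ => 0), (fun _ => 1)} : Set (Fin k → Fin 2))ᶜ := by
    ext S
    simp only [Set.mem_setOf_eq, Set.mem_image, Set.mem_compl_iff, Set.mem_insert_iff,
      Set.mem_singleton_iff, not_or]
    constructor
    · rintro ⟨f, rfl, h⟩
      exact ⟨f, h, rfl⟩
    · rintro ⟨f, h, rfl⟩
      exact ⟨f, rfl, h⟩
  have hinj : Function.Injective
      (fun f : Fin k → Fin 2 => Set.range (fun i => (f i, i))) := by
    intro f g hfg
    funext l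
    have hmem : (f l, l) ∈ Set.range (fun i => (g i, i)) := by
      have hfg' : Set.range (fun i => (f i, i)) = Set.range (fun i => (g i, i)) := hfg
      rw [← hfg']
      exact ⟨l, rfl⟩
    obtain ⟨m, hm⟩ := hmem
    simp only [Prod.mk.injEq] at hm
    obtain ⟨hm1, rfl⟩ := hm
    exact hm1.symm
  have hne : (fun _ => 0 : Fin k → Fin 2) ≠ (fun _ => 1) := by
    intro h
    have := congrFun h ⟨0, by omega⟩
    simp at this
  rw [himg, Set.ncard_image_of_injective _ hinj, Set.ncard_compl, Set.ncard_pair hne]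
  simp

/-- for `k ≥ 3`, the minimal separators of the `(k,1)`-prism are exactly
the transversals of the matching (one endpoint of each edge `xᵢyᵢ`) other than
`{x₁,…,x_k}` and `{y₁,…,y_k}`; in particular there are exactly `2^k − 2` of them. -/
theorem prism_minimalSeparators
    (k : ℕ) (hk : 3 ≤ k) :
    {S : Set (Fin 2 × Fin k) | IsMinimalSeparator (prism k) S} =
      {S | ∃ f : Fin k → Fin 2, S = Set.range (fun i => (f i, i)) ∧
        f ≠ (fun _ => 0) ∧ f ≠ (fun _ => 1)} ∧
    {S : Set (Fin 2 × Fin k) | IsMinimalSeparator (prism k) S}.ncard = 2 ^ k - 2 := by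
  rw [prism_minSep_eq k]
  exact ⟨rfl, prism_transversal_count k hk⟩
end

section
/- Let G be a finite simple graph and S ⊆ V(G). Then S is a minimal separator of G if and only if there exist at least two distinct connected components A and B of G − S with N(A) = N(B) = S. -/
open SimpleGraph

theorem cross_aux {V : Type*} {G : SimpleGraph V} {A : Set V} {x y : V} (p : G.Walk x y)
    (hx : x ∈ A) (hy : y ∉ A) : ∃ a ∈ A, ∃ b, b ∉ A ∧ G.Adj a b ∧ b ∈ p.support := by
  induction p with
  | nil => exact absurd hx hy
  | @cons x z y h p ih =>
    by_cases hz : z ∈ A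
    · obtain ⟨a, ha, b, hb, hab, hbs⟩ := ih hz hy
      exact ⟨a, ha, b, hb, hab, by simp [hbs]⟩
    · exact ⟨x, hx, z, hz, h, by simp⟩

theorem walk_in_comp {V : Type*} {G : SimpleGraph V} {A : Set V}
    (hA : (G.induce A).Connected) {x y : V} (hx : x ∈ A) (hy : y ∈ A) :
    ∃ p : G.Walk x y, ∀ w ∈ p.support, w ∈ A := by
  obtain ⟨q⟩ := hA.preconnected ⟨x, hx⟩ ⟨y, hy⟩
  refine ⟨q.map (Embedding.induce A).toHom, ?_⟩
  intro w hw
  have hw' := (congrArg (w ∈ ·) (Walk.support_map (Embedding.induce A).toHom q)).mp hw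
  obtain ⟨z, -, rfl⟩ := List.mem_map.mp hw'
  exact z.2

theorem comp_subset {V : Type*} {G : SimpleGraph V} {U A B : Set V}
    (hA : IsCompOf G U A) (hB : IsCompOf G U B) {x : V} (hxA : x ∈ A) (hxB : x ∈ B) :
    A ⊆ B := by
  intro y hy
  by_contra hyB
  obtain ⟨p, hp⟩ := walk_in_comp hA.2.2.1 hxA hy
  obtain ⟨a, ha, b, hb, hab, hbs⟩ := cross_aux p hxB hyB
  exact hb (hB.2.2.2 a ha b (hA.1 (hp b hbs)) hab)

/-- Vertices reachable from `u` avoiding `S`. -/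
def reachSet {V : Type*} (G : SimpleGraph V) (S : Set V) (u : V) : Set V :=
  {x | ∃ p : G.Walk u x, ∀ w ∈ p.support, w ∉ S}

theorem self_mem_reachSet {V : Type*} {G : SimpleGraph V} {S : Set V} {u : V} (hu : u ∉ S) :
    u ∈ reachSet G S u := ⟨Walk.nil, by simpa using hu⟩

theorem reachSet_comp {V : Type*} {G : SimpleGraph V} {S : Set V} {u : V} (hu : u ∉ S) :
    IsCompOf G Sᶜ (reachSet G S u) := by
  classical
  refine ⟨?_, ⟨u, self_mem_reachSet hu⟩, ?_, ?_⟩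
  · rintro x ⟨p, hp⟩
    exact hp x p.end_mem_support
  · refine induce_connected_of_patches u (self_mem_reachSet hu) ?_
    rintro v ⟨p, hp⟩
    refine ⟨{w | w ∈ p.support}, ?_, p.start_mem_support, p.end_mem_support,
      p.connected_induce_support.preconnected _ _⟩
    intro w hw
    exact ⟨p.takeUntil w hw, fun z hz => hp z (p.support_takeUntil_subset_support hw hz)⟩
  · rintro a ⟨p, hp⟩ b hb hab
    refine ⟨p.concat hab, fun w hw => ?_⟩
    rw [Walk.support_concat] at hw
    simp only [List.mem_append, List.mem_singleton] at hw
    rcases hw with hw | rfl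
    · exact hp w hw
    · exact hb

theorem nbhd_comp {V : Type*} {G : SimpleGraph V} {S A : Set V} (hA : IsCompOf G Sᶜ A) {u v : V}
    (hu : u ∈ A) (hv : v ∉ A)
    (h : ∀ s ∈ S, ∃ p : G.Walk u v, ∀ w ∈ p.support, w ∈ S → w = s) : nbhd G A = S := by
  ext s
  constructor
  · rintro ⟨hs, a, ha, hsa⟩
    by_contra hsS
    exact hs (hA.2.2.2 a ha s hsS hsa.symm)
  · intro hs
    refine ⟨fun hsA => hA.1 hsA hs, ?_⟩
    obtain ⟨p, hp⟩ := h s hs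
    obtain ⟨a, ha, b, hb, hab, hbs⟩ := cross_aux p hu hv
    have hbS : b ∈ S := by
      by_contra hbS
      exact hb (hA.2.2.2 a ha b hbS hab)
    obtain rfl := hp b hbs hbS
    exact ⟨a, ha, hab.symm⟩

/-- `S` is a minimal separator of `G` iff there are two distinct connected
components `A, B` of `G − S` with `N(A) = N(B) = S`. -/
theorem isMinimalSeparator_iff_two_full_components
    {V : Type*} [Fintype V] (G : SimpleGraph V) (S : Set V) :
    IsMinimalSeparator G S ↔
      ∃ A B : Set V, A ≠ B ∧ IsCompOf G Sᶜ A ∧ IsCompOf G Sᶜ B ∧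
        nbhd G A = S ∧ nbhd G B = S := by
  constructor
  · rintro ⟨u, v, ⟨hu, hv, hsep⟩, hmin⟩
    have hwalk : ∀ s ∈ S, ∃ p : G.Walk u v, ∀ w ∈ p.support, w ∈ S → w = s := by
      intro s hs
      by_contra hcon
      push Not at hcon
      refine hmin (S \ {s}) ⟨Set.sdiff_subset, fun hsub => (hsub hs).2 rfl⟩
        ⟨fun h => hu h.1, fun h => hv h.1, fun p => ?_⟩
      obtain ⟨w, hw, hwS, hne⟩ := hcon p
      exact ⟨w, hw, hwS, hne⟩
    have hvA : v ∉ reachSet G S u := by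
      rintro ⟨p, hp⟩
      obtain ⟨w, hw, hwS⟩ := hsep p
      exact hp w hw hwS
    have huB : u ∉ reachSet G S v := by
      rintro ⟨p, hp⟩
      obtain ⟨w, hw, hwS⟩ := hsep p.reverse
      exact hp w (by simpa using hw) hwS
    refine ⟨reachSet G S u, reachSet G S v, ?_, reachSet_comp hu, reachSet_comp hv,
      nbhd_comp (reachSet_comp hu) (self_mem_reachSet hu) hvA hwalk,
      nbhd_comp (reachSet_comp hv) (self_mem_reachSet hv) huB ?_⟩
    · intro h
      exact hvA (h ▸ self_mem_reachSet hv)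
    · intro s hs
      obtain ⟨p, hp⟩ := hwalk s hs
      exact ⟨p.reverse, fun w hw => hp w (by simpa using hw)⟩
  · rintro ⟨A, B, hne, hA, hB, hNA, hNB⟩
    obtain ⟨u, hu⟩ := hA.2.1
    obtain ⟨v, hv⟩ := hB.2.1
    have hvA : v ∉ A := fun h =>
      hne ((comp_subset hA hB h hv).antisymm (comp_subset hB hA hv h))
    refine ⟨u, v, ⟨hA.1 hu, hB.1 hv, fun p => ?_⟩, ?_⟩
    · obtain ⟨a, ha, b, hb, hab, hbs⟩ := cross_aux p hu hvA
      refine ⟨b, hbs, ?_⟩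
      by_contra hbS
      exact hb (hA.2.2.2 a ha b hbS hab)
    · rintro S' hS' ⟨-, -, hsep⟩
      obtain ⟨s, hs, hsS'⟩ := Set.exists_of_ssubset hS'
      obtain ⟨-, a, ha, hsa⟩ : s ∈ nbhd G A := by rw [hNA]; exact hs
      obtain ⟨-, b, hb, hsb⟩ : s ∈ nbhd G B := by rw [hNB]; exact hs
      obtain ⟨p, hp⟩ := walk_in_comp hA.2.2.1 hu ha
      obtain ⟨q, hq⟩ := walk_in_comp hB.2.2.1 hb hv
      obtain ⟨w, hw, hwS⟩ := hsep (p.append (Walk.cons hsa.symm (Walk.cons hsb q)))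
      rw [Walk.mem_support_append_iff] at hw
      simp only [Walk.support_cons, List.mem_cons] at hw
      rcases hw with hw | rfl | rfl | hw
      · exact hA.1 (hp w hw) (hS'.1 hwS)
      · exact hA.1 ha (hS'.1 hwS)
      · exact hsS' hwS
      · exact hB.1 (hq w hw) (hS'.1 hwS)
end
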